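/- arXiv:2206.14909 — 2 statements merged into one kernel-verified Lean document; each statement's English description precedes it below -/
import Mathlib

section
/- Let G be a bridgeless 3-regular graph with oddness 2. Then the edge set of G can be partitioned into four matchings M1, M2, M3, M4 such that: (i) M1 is a perfect matching; (ii) the spanning subgraph with edge set M2 ∪ M3 ∪ M4 is a 2-factor having exactly two components that are odd cycles, say c and c'; and (iii) there exist vertices u on c and u' on c' and a path P from u to u' in G that uses only edges of M1 ∪ M2 and contains no vertex of c or of c' other than its endpoints u and u'. -/
open scoped Classical

noncomputable section

/-- A point of the Euclidean plane. -/
abbrev Pt : Type := ℝ × ℝ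

/-- The segments with endpoints `a, b` and `c, d` are orthogonal:
their direction vectors have zero inner product. -/
def SegOrth (a b c d : Pt) : Prop :=
  (b.1 - a.1) * (d.1 - c.1) + (b.2 - a.2) * (d.2 - c.2) = 0

/-- The degree of a vertex in a simple graph. -/
def vdeg {V : Type*} (G : SimpleGraph V) (v : V) : ℕ := (G.neighborSet v).ncard

/-- `M` is a matching in `G`: a set of edges of `G` that are pairwise non-adjacent. -/
def IsMatchingOn {V : Type*} (G : SimpleGraph V) (M : Set (Sym2 V)) : Prop :=
  M ⊆ G.edgeSet ∧ ∀ e ∈ M, ∀ f ∈ M, e ≠ f → ∀ v : V, v ∈ e → v ∉ f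

/-- `G` is `k`-edge-colorable: its edge set is partitioned into `k` matchings. -/
def EdgeColorable {V : Type*} (G : SimpleGraph V) (k : ℕ) : Prop :=
  ∃ M : Fin k → Set (Sym2 V),
    (∀ i, IsMatchingOn G (M i)) ∧
    (∀ i j, i ≠ j → Disjoint (M i) (M j)) ∧
    (⋃ i, M i) = G.edgeSet

/-- `p` is a straight-line RAC drawing of `G`: vertices are at pairwise distinct points,
each edge is the closed segment between its endpoints, no edge passes through another
vertex, edges sharing an endpoint meet only there, and any two edges with no common
endpoint that intersect do so orthogonally. -/
structure IsRACDrawing {V : Type*} (G : SimpleGraph V) (p : V → Pt) : Prop where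
  inj : Function.Injective p
  vertex_off : ∀ u v w : V, G.Adj u v → w ≠ u → w ≠ v →
    p w ∉ segment ℝ (p u) (p v)
  shared : ∀ u v w : V, G.Adj u v → G.Adj u w → v ≠ w →
    segment ℝ (p u) (p v) ∩ segment ℝ (p u) (p w) ⊆ {p u}
  rac : ∀ u v u' v' : V, G.Adj u v → G.Adj u' v' →
    u ≠ u' → u ≠ v' → v ≠ u' → v ≠ v' →
    (segment ℝ (p u) (p v) ∩ segment ℝ (p u') (p v')).Nonempty →
    SegOrth (p u) (p v) (p u') (p v')

/-- All points of `P` are integer grid points lying in an axis-aligned square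
of side length `side`. -/
def InGridSquare (side : ℝ) (P : Set Pt) : Prop :=
  (∀ q ∈ P, ∃ a b : ℤ, q = ((a : ℝ), (b : ℝ))) ∧
  ∃ x0 y0 : ℝ, ∀ q ∈ P, x0 ≤ q.1 ∧ q.1 ≤ x0 + side ∧ y0 ≤ q.2 ∧ q.2 ≤ y0 + side

/-- The list of consecutive segments (as pairs of endpoints) of a polyline given
by its list of points. -/
def polySegs (l : List Pt) : List (Pt × Pt) := l.zip l.tail

/-- The set of plane points covered by a polyline given by its list of points. -/
def polySet (l : List Pt) : Set Pt := ⋃ s ∈ polySegs l, segment ℝ s.1 s.2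

/-- `p, poly` is a `k`-bend RAC drawing of `G`: each edge `e` is drawn as the polyline
through the list of points `poly e` (at most `k + 1` segments, i.e. at most `k + 2`
points) joining the two endpoints of `e`; no edge passes through another vertex; edges
sharing an endpoint meet only at that endpoint; any two distinct edges intersect in
finitely many points; and wherever segments of two distinct edges meet (other than at
the point of a common endvertex) the two segments are orthogonal. -/
structure IsBendRACDrawing {V : Type*} (k : ℕ) (G : SimpleGraph V)
    (p : V → Pt) (poly : Sym2 V → List Pt) : Prop where
  inj : Function.Injective p
  ends : ∀ e ∈ G.edgeSet, ∃ u v : V, e = s(u, v) ∧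
    (poly e).head? = some (p u) ∧ (poly e).getLast? = some (p v)
  nsegs : ∀ e ∈ G.edgeSet, 2 ≤ (poly e).length ∧ (poly e).length ≤ k + 2
  vertex_off : ∀ e ∈ G.edgeSet, ∀ w : V, w ∉ e → p w ∉ polySet (poly e)
  shared : ∀ e ∈ G.edgeSet, ∀ e' ∈ G.edgeSet, e ≠ e' → ∀ w : V, w ∈ e → w ∈ e' →
    polySet (poly e) ∩ polySet (poly e') ⊆ {p w}
  fin_inter : ∀ e ∈ G.edgeSet, ∀ e' ∈ G.edgeSet, e ≠ e' →
    (polySet (poly e) ∩ polySet (poly e')).Finite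
  rac : ∀ e ∈ G.edgeSet, ∀ e' ∈ G.edgeSet, e ≠ e' →
    ∀ s ∈ polySegs (poly e), ∀ s' ∈ polySegs (poly e'),
    ∀ x : Pt, x ∈ segment ℝ s.1 s.2 → x ∈ segment ℝ s'.1 s'.2 →
    (∀ w : V, w ∈ e → w ∈ e' → x ≠ p w) →
    SegOrth s.1 s.2 s'.1 s'.2

/-- All vertex points and bend points of a polyline drawing. -/
def drawingPoints {V : Type*} (G : SimpleGraph V) (p : V → Pt)
    (poly : Sym2 V → List Pt) : Set Pt :=
  Set.range p ∪ {q | ∃ e ∈ G.edgeSet, q ∈ poly e}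

/-- `F` is (the edge set of) a 2-factor of `G`: a spanning subgraph in which every
vertex has degree exactly 2. -/
def Is2Factor {V : Type*} (G : SimpleGraph V) (F : Set (Sym2 V)) : Prop :=
  F ⊆ G.edgeSet ∧ ∀ v : V, {e ∈ F | v ∈ e}.ncard = 2

/-- The connected components of the (2-regular) spanning subgraph with edge set `F`
that are odd cycles, i.e. have an odd number of vertices. -/
def oddComps {V : Type*} (F : Set (Sym2 V)) :
    Set ((SimpleGraph.fromEdgeSet F).ConnectedComponent) :=
  {C | Odd C.supp.ncard}

/-- `G` has oddness `k`: the minimum over all 2-factors of the number of odd-cycle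
components equals `k` (in particular a 2-factor exists). -/
def HasOddness {V : Type*} (G : SimpleGraph V) (k : ℕ) : Prop :=
  (∃ F, Is2Factor G F ∧ (oddComps F).ncard = k) ∧
  (∀ F, Is2Factor G F → k ≤ (oddComps F).ncard)

/-- `G` has no cut-edge. -/
def Bridgeless {V : Type*} (G : SimpleGraph V) : Prop := ∀ e, ¬ G.IsBridge e

/-- Every component of a finite 2-regular graph is a cyclically indexed list of vertices. -/
lemma comp_cycle {V : Type} [Fintype V] (A : SimpleGraph V)
    (h2 : ∀ v, (A.neighborSet v).ncard = 2) (C : A.ConnectedComponent) :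
    ∃ (n : ℕ) (g : ℕ → V), 3 ≤ n ∧ g n = g 0 ∧
      (∀ i j, i < n → j < n → g i = g j → i = j) ∧
      (∀ v, v ∈ C.supp ↔ ∃ i < n, g i = v) ∧
      (∀ a ∈ C.supp, ∀ b, A.Adj a b ↔ ∃ i < n, s(g i, g (i+1)) = s(a, b)) ∧
      C.supp.ncard = n := by
  obtain ⟨v, hv⟩ := C.nonempty_supp
  have hcyc : A.IsCycles := fun w _ => h2 w
  have hn : (A.neighborSet v).Nonempty := by
    apply Set.nonempty_of_ncard_ne_zero
    rw [h2]; decide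
  obtain ⟨p, hp, hpv⟩ := hcyc.exists_cycle_toSubgraph_verts_eq_connectedComponentSupp hv hn
  have h3 := hp.three_le_length
  have hinj : ∀ i j, i < p.length → j < p.length → p.getVert i = p.getVert j → i = j := by
    intro i j hi hj hij
    exact hp.getVert_injOn' (by simp only [Set.mem_setOf_eq]; omega)
      (by simp only [Set.mem_setOf_eq]; omega) hij
  have hg0 : p.getVert p.length = p.getVert 0 := by simp
  have hsupp : ∀ w, w ∈ C.supp ↔ ∃ i < p.length, p.getVert i = w := by
    intro w
    rw [← hpv, SimpleGraph.Walk.mem_verts_toSubgraph,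
      SimpleGraph.Walk.mem_support_iff_exists_getVert]
    constructor
    · rintro ⟨i, hi, hle⟩
      rcases hle.lt_or_eq with h | h
      · exact ⟨i, h, hi⟩
      · exact ⟨0, by omega, by rw [← hg0, ← h, hi]⟩
    · rintro ⟨i, hi, hw⟩
      exact ⟨i, hw, hi.le⟩
  refine ⟨p.length, p.getVert, h3, hg0, hinj, hsupp, ?_, ?_⟩
  · intro a ha b
    rw [← hp.adj_toSubgraph_iff_of_isCycles hcyc (hpv ▸ ha), SimpleGraph.Walk.toSubgraph_adj_iff]
    constructor
    · rintro ⟨i, h, hi⟩; exact ⟨i, hi, h⟩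
    · rintro ⟨i, hi, h⟩; exact ⟨i, h, hi⟩
  · have : C.supp = p.getVert '' (Set.Iio p.length) := by
      ext w; rw [hsupp]; simp
    rw [this, Set.ncard_image_of_injOn]
    · simp [Set.ncard_eq_toFinset_card']
    · intro i hi j hj hij
      exact hinj i j hi hj hij

/-- Degree in the edge set equals the size of the neighbour set. -/
lemma ncard_inc {V : Type} [Fintype V] (G : SimpleGraph V) (v : V) :
    {e ∈ G.edgeSet | v ∈ e}.ncard = (G.neighborSet v).ncard := by
  have : {e ∈ G.edgeSet | v ∈ e} = (fun w => s(v, w)) '' G.neighborSet v := by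
    ext e
    induction e using Sym2.ind with
    | _ a b =>
      simp only [Set.mem_setOf_eq, SimpleGraph.mem_edgeSet, Sym2.mem_iff, Set.mem_image,
        SimpleGraph.mem_neighborSet, Sym2.eq_iff]
      constructor
      · rintro ⟨h, rfl | rfl⟩
        · exact ⟨b, h, Or.inl ⟨rfl, rfl⟩⟩
        · exact ⟨a, h.symm, Or.inr ⟨rfl, rfl⟩⟩
      · rintro ⟨w, h, ⟨rfl, rfl⟩ | ⟨rfl, rfl⟩⟩
        · exact ⟨h, Or.inl rfl⟩
        · exact ⟨h.symm, Or.inr rfl⟩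
  rw [this, Set.ncard_image_of_injective]
  intro a b h
  exact Sym2.congr_right.mp h

/-- Handshake: the only two odd vertices of a graph lie in one component. -/
lemma reach_of_odd {V : Type} [Fintype V] (H : SimpleGraph V) (x x' : V)
    (hx : Odd (H.neighborSet x).ncard)
    (ho : ∀ v, Odd (H.neighborSet v).ncard → v = x ∨ v = x') : H.Reachable x x' := by
  let D := H.connectedComponentMk x
  have hdeg : ∀ v : D.supp, D.toSimpleGraph.degree v = (H.neighborSet v.1).ncard := by
    intro v
    rw [← SimpleGraph.card_neighborSet_eq_degree, ← Nat.card_eq_fintype_card, Nat.card_coe_set_eq]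
    have : H.neighborSet v.1 = Subtype.val '' (D.toSimpleGraph.neighborSet v) := by
      ext w
      constructor
      · intro hw
        have hwD : w ∈ D.supp := by
          have h1 := v.2
          rw [SimpleGraph.ConnectedComponent.mem_supp_iff] at h1 ⊢
          rw [← h1]
          exact SimpleGraph.ConnectedComponent.sound (SimpleGraph.Adj.reachable hw).symm
        exact ⟨⟨w, hwD⟩, hw, rfl⟩
      · rintro ⟨w, hw, rfl⟩
        exact hw
    rw [this, Set.ncard_image_of_injective _ Subtype.val_injective]
  have hxD : x ∈ D.supp := rfl
  obtain ⟨w, hne, hw⟩ := D.toSimpleGraph.exists_ne_odd_degree_of_exists_odd_degree ⟨x, hxD⟩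
    (by rw [hdeg]; exact hx)
  rw [hdeg] at hw
  rcases ho _ hw with h | h
  · exact absurd (Subtype.ext h) hne
  · have := w.2
    rw [h] at this
    exact (SimpleGraph.ConnectedComponent.exact this).symm

/-- Colouring of a 2-factor: alternate around every cycle, with one spare edge if odd. -/
lemma coloring {V : Type} [Fintype V] (G : SimpleGraph V) (F : Set (Sym2 V))
    (hF : Is2Factor G F) :
    ∃ M2 M3 M4 : Set (Sym2 V), M2 ∪ M3 ∪ M4 = F ∧
      IsMatchingOn G M2 ∧ IsMatchingOn G M3 ∧ IsMatchingOn G M4 ∧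
      Disjoint M2 M3 ∧ Disjoint M2 M4 ∧ Disjoint M3 M4 ∧
      ∃ r : (SimpleGraph.fromEdgeSet F).ConnectedComponent → V,
        (∀ C, r C ∈ C.supp) ∧
        ∀ C, ∀ v ∈ C.supp, (∃ e ∈ M2, v ∈ e) ↔ ¬ (v = r C ∧ Odd C.supp.ncard) := by
  set A := SimpleGraph.fromEdgeSet F with hA
  have hAF : A.edgeSet = F := by
    rw [hA, SimpleGraph.edgeSet_fromEdgeSet]
    refine sdiff_eq_left.mpr (Set.disjoint_left.mpr fun e he hd => ?_)
    exact G.not_isDiag_of_mem_edgeSet (hF.1 he) hd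
  have h2 : ∀ v, (A.neighborSet v).ncard = 2 := by
    intro v
    rw [← ncard_inc, hAF]
    exact hF.2 v
  choose n g h3 hg0 hinj hsupp hadj hcard using comp_cycle A h2
  let E : A.ConnectedComponent → ℕ → Sym2 V := fun C i => s(g C i, g C (i+1))
  have hEF : ∀ C i, i < n C → E C i ∈ F := by
    intro C i hi
    rw [← hAF, SimpleGraph.mem_edgeSet]
    exact (hadj C _ ((hsupp C _).2 ⟨i, hi, rfl⟩) _).2 ⟨i, hi, rfl⟩
  have hFE : ∀ e ∈ F, ∃ C i, i < n C ∧ e = E C i := by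
    intro e he
    rw [← hAF] at he
    induction e using Sym2.ind with
    | _ a b =>
      obtain ⟨i, hi, h⟩ := (hadj (A.connectedComponentMk a) a rfl b).1 he
      exact ⟨_, i, hi, h.symm⟩
  -- membership of a vertex in an edge
  have hmem : ∀ C i, i < n C → ∀ v, v ∈ E C i ↔
      ∃ j < n C, g C j = v ∧ (j = i ∨ j = i + 1 ∨ (j = 0 ∧ i + 1 = n C)) := by
    intro C i hi v
    simp only [E, Sym2.mem_iff]
    constructor
    · rintro (rfl | rfl)
      · exact ⟨i, hi, rfl, Or.inl rfl⟩
      · rcases Nat.lt_or_ge (i+1) (n C) with h | h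
        · exact ⟨i+1, h, rfl, Or.inr (Or.inl rfl)⟩
        · have : i + 1 = n C := by omega
          exact ⟨0, by omega, by rw [this, hg0], Or.inr (Or.inr ⟨rfl, this⟩)⟩
    · rintro ⟨j, hj, rfl, rfl | rfl | ⟨rfl, h⟩⟩
      · exact Or.inl rfl
      · exact Or.inr rfl
      · right; rw [h, hg0]
  have hcomp : ∀ C i, i < n C → ∀ v, v ∈ E C i → v ∈ C.supp := by
    intro C i hi v hv
    obtain ⟨j, hj, h, -⟩ := (hmem C i hi v).1 hv
    exact (hsupp C v).2 ⟨j, hj, h⟩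
  -- two edges sharing a vertex
  have hshare : ∀ C i C' i', i < n C → i' < n C' → ∀ v, v ∈ E C i → v ∈ E C' i' →
      C = C' ∧ (i = i' ∨ i + 1 = i' ∨ i' + 1 = i ∨ (i = 0 ∧ i' + 1 = n C) ∨
        (i' = 0 ∧ i + 1 = n C)) := by
    intro C i C' i' hi hi' v hv hv'
    have hCC : C = C' := by
      have a1 := hcomp C i hi v hv
      have a2 := hcomp C' i' hi' v hv'
      rw [SimpleGraph.ConnectedComponent.mem_supp_iff] at a1 a2
      exact a1.symm.trans a2
    subst hCC
    refine ⟨rfl, ?_⟩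
    obtain ⟨j, hj, h, h'⟩ := (hmem C i hi v).1 hv
    obtain ⟨k, hk, t, t'⟩ := (hmem C i' hi' v).1 hv'
    have := hinj C j k hj hk (h.trans t.symm)
    omega
  -- edges are determined by their index
  have hEinj : ∀ C i C' i', i < n C → i' < n C' → E C i = E C' i' → C = C' ∧ i = i' := by
    intro C i C' i' hi hi' he
    have hCC := (hshare C i C' i' hi hi' (g C i) (by simp [E]) (by rw [← he]; simp [E])).1
    subst hCC
    refine ⟨rfl, ?_⟩
    have h3C := h3 C
    obtain ⟨j, hj, h, h'⟩ := (hmem C i' hi' (g C i)).1 (by rw [← he]; simp [E])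
    obtain ⟨k, hk, t, t'⟩ := (hmem C i hi (g C i')).1 (by rw [he]; simp [E])
    have e1 := hinj C j i hj hi h
    have e2 := hinj C k i' hk hi' t
    omega
  let M (P : ℕ → ℕ → Prop) : Set (Sym2 V) := {e | ∃ C i, i < n C ∧ P (n C) i ∧ e = E C i}
  have hmatch : ∀ P : ℕ → ℕ → Prop,
      (∀ m i i', 3 ≤ m → i < m → i' < m → P m i → P m i' →
        (i + 1 = i' ∨ i' + 1 = i ∨ (i = 0 ∧ i' + 1 = m) ∨ (i' = 0 ∧ i + 1 = m)) → False) →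
      IsMatchingOn G (M P) := by
    intro P hP
    refine ⟨?_, ?_⟩
    · rintro e ⟨C, i, hi, -, rfl⟩
      exact hF.1 (hEF C i hi)
    · rintro e ⟨C, i, hi, p, rfl⟩ f ⟨C', i', hi', p', rfl⟩ hne v hv hv'
      obtain ⟨rfl, h⟩ := hshare C i C' i' hi hi' v hv hv'
      rcases h with rfl | h
      · exact hne rfl
      · exact hP (n C) i i' (h3 C) hi hi' p p' h
  have hdisj : ∀ P Q : ℕ → ℕ → Prop, (∀ m i, P m i → Q m i → False) → Disjoint (M P) (M Q) := by
    intro P Q h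
    refine Set.disjoint_left.mpr ?_
    rintro e ⟨C, i, hi, p, rfl⟩ ⟨C', i', hi', p', he⟩
    obtain ⟨rfl, rfl⟩ := hEinj C i C' i' hi hi' he
    exact h _ _ p p'
  let P2 : ℕ → ℕ → Prop := fun _ i => i % 2 = 1
  let P3 : ℕ → ℕ → Prop := fun m i => i % 2 = 0 ∧ i + 1 < m
  let P4 : ℕ → ℕ → Prop := fun m i => i % 2 = 0 ∧ i + 1 = m
  refine ⟨M P2, M P3, M P4, ?_, hmatch P2 ?_, hmatch P3 ?_, hmatch P4 ?_,
    hdisj P2 P3 ?_, hdisj P2 P4 ?_, hdisj P3 P4 ?_, fun C => g C 0, ?_, ?_⟩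
  · ext e
    constructor
    · rintro ((⟨C, i, hi, -, rfl⟩ | ⟨C, i, hi, -, rfl⟩) | ⟨C, i, hi, -, rfl⟩) <;> exact hEF C i hi
    · intro he
      obtain ⟨C, i, hi, rfl⟩ := hFE e he
      rcases Nat.mod_two_eq_zero_or_one i with h | h
      · rcases Nat.lt_or_ge (i+1) (n C) with h' | h'
        · exact Or.inl (Or.inr ⟨C, i, hi, ⟨h, h'⟩, rfl⟩)
        · exact Or.inr ⟨C, i, hi, ⟨h, by omega⟩, rfl⟩
      · exact Or.inl (Or.inl ⟨C, i, hi, h, rfl⟩)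
  · simp only [P2, P3, P4]; intros; omega
  · simp only [P2, P3, P4]; intros; omega
  · simp only [P2, P3, P4]; intros; omega
  · simp only [P2, P3, P4]; intros; omega
  · simp only [P2, P3, P4]; intros; omega
  · simp only [P2, P3, P4]; intros; omega
  · intro C
    have := h3 C
    exact (hsupp C _).2 ⟨0, by omega, rfl⟩
  · intro C v hv
    have h3C := h3 C
    obtain ⟨j, hj, rfl⟩ := (hsupp C v).1 hv
    rw [hcard, Nat.odd_iff]
    constructor
    · rintro ⟨e, ⟨C', i, hi, hodd, rfl⟩, hve⟩ ⟨h0, hn⟩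
      have hCC : C' = C := by
        have a1 := hcomp C' i hi _ hve
        rw [SimpleGraph.ConnectedComponent.mem_supp_iff] at a1 hv
        exact a1.symm.trans hv
      subst hCC
      simp only [P2] at hodd
      obtain ⟨k, hk, t, t'⟩ := (hmem C' i hi _).1 hve
      have e1 := hinj C' k j hk hj t
      have e2 := hinj C' j 0 hj (by omega) h0
      omega
    · intro hnot
      have key : ∃ i, i < n C ∧ i % 2 = 1 ∧ (j = i ∨ j = i + 1 ∨ (j = 0 ∧ i + 1 = n C)) := by
        rcases Nat.mod_two_eq_zero_or_one j with h | h
        · rcases Nat.eq_zero_or_pos j with rfl | hpos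
          · have : ¬ n C % 2 = 1 := fun hh => hnot ⟨rfl, hh⟩
            exact ⟨n C - 1, by omega, by omega, by omega⟩
          · exact ⟨j - 1, by omega, by omega, by omega⟩
        · exact ⟨j, hj, h, Or.inl rfl⟩
      obtain ⟨i, hi, ho, hh⟩ := key
      exact ⟨E C i, ⟨C, i, hi, ho, rfl⟩, (hmem C i hi _).2 ⟨j, hj, rfl, hh⟩⟩

/-- A shortest walk between two disjoint sets is a path meeting them only at its ends. -/
lemma shortest {V : Type} (H : SimpleGraph V) (S T : Set V) (x x' : V) (hx : x ∈ S) (hx' : x' ∈ T)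
    (hr : H.Reachable x x') :
    ∃ u u', u ∈ S ∧ u' ∈ T ∧ ∃ P : H.Walk u u', P.IsPath ∧
      ∀ w ∈ P.support, w ∈ S ∪ T → w = u ∨ w = u' := by
  have hex : ∃ k, ∃ u u', u ∈ S ∧ u' ∈ T ∧ ∃ P : H.Walk u u', P.length = k := by
    obtain ⟨p⟩ := hr
    exact ⟨_, x, x', hx, hx', p, rfl⟩
  obtain ⟨u, u', hu, hu', P, hP⟩ := Nat.find_spec hex
  have hmin : ∀ a b, a ∈ S → b ∈ T → ∀ Q : H.Walk a b, P.length ≤ Q.length := by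
    intro a b ha hb Q
    rw [hP]
    exact Nat.find_min' hex ⟨a, b, ha, hb, Q, rfl⟩
  refine ⟨u, u', hu, hu', P, ?_, ?_⟩
  · have h1 := hmin u u' hu hu' P.bypass
    have := P.bypass_eq_self_of_length_le_length_bypass h1
    rw [← this]
    exact P.bypass_isPath
  · intro w hw hST
    by_contra hcon
    push Not at hcon
    rcases hST with h | h
    · exact absurd (hmin w u' h hu' (P.dropUntil w hw))
        (not_le.mpr (SimpleGraph.Walk.length_dropUntil_lt_length hw hcon.1))
    · exact absurd (hmin u w hu h (P.takeUntil w hw))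
        (not_le.mpr (SimpleGraph.Walk.length_takeUntil_lt_length hw hcon.2))

/-- Let `G` be a bridgeless 3-regular graph with oddness 2. Then the
edge set of `G` can be partitioned into four matchings `M1, M2, M3, M4` such that:
(i) `M1` is a perfect matching; (ii) `M2 ∪ M3 ∪ M4` is a 2-factor having exactly two
odd-cycle components `c` and `c'`; and (iii) there are vertices `u ∈ c`, `u' ∈ c'` and a
path from `u` to `u'` in `G` using only edges of `M1 ∪ M2` and containing no vertex of
`c` or `c'` other than its endpoints. -/
theorem stmt10 (V : Type) [Fintype V] (G : SimpleGraph V)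
    (h3reg : ∀ v : V, vdeg G v = 3) (hbr : Bridgeless G)
    (hodd : HasOddness G 2) :
    ∃ M1 M2 M3 M4 : Set (Sym2 V),
      IsMatchingOn G M1 ∧ IsMatchingOn G M2 ∧ IsMatchingOn G M3 ∧ IsMatchingOn G M4 ∧
      Disjoint M1 M2 ∧ Disjoint M1 M3 ∧ Disjoint M1 M4 ∧
      Disjoint M2 M3 ∧ Disjoint M2 M4 ∧ Disjoint M3 M4 ∧
      M1 ∪ M2 ∪ M3 ∪ M4 = G.edgeSet ∧
      (∀ v : V, ∃ e ∈ M1, v ∈ e) ∧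
      Is2Factor G (M2 ∪ M3 ∪ M4) ∧
      ∃ c c' : (SimpleGraph.fromEdgeSet (M2 ∪ M3 ∪ M4)).ConnectedComponent,
        c ≠ c' ∧ oddComps (M2 ∪ M3 ∪ M4) = {c, c'} ∧
        ∃ (u u' : V), u ∈ c.supp ∧ u' ∈ c'.supp ∧
          ∃ P : G.Walk u u', P.IsPath ∧
            (∀ e ∈ P.edges, e ∈ M1 ∪ M2) ∧
            (∀ w ∈ P.support, w ∈ c.supp ∪ c'.supp → w = u ∨ w = u') := by
  obtain ⟨⟨F, hF, hcardF⟩, -⟩ := hodd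
  obtain ⟨M2, M3, M4, hEq, m2, m3, m4, d23, d24, d34, r, hr, hcov⟩ := coloring G F hF
  obtain ⟨c, c', hne, hcc⟩ := Set.ncard_eq_two.mp hcardF
  -- exactly one edge outside the 2-factor at each vertex
  have hone : ∀ v, {e ∈ G.edgeSet \ F | v ∈ e}.ncard = 1 := by
    intro v
    have h1 : {e ∈ G.edgeSet \ F | v ∈ e} = {e ∈ G.edgeSet | v ∈ e} \ {e ∈ F | v ∈ e} := by
      ext e
      simp only [Set.mem_setOf_eq, Set.mem_sdiff]
      tauto
    have hsub : {e ∈ F | v ∈ e} ⊆ {e ∈ G.edgeSet | v ∈ e} := fun e he => ⟨hF.1 he.1, he.2⟩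
    rw [h1, Set.ncard_sdiff hsub, ncard_inc, hF.2 v]
    have := h3reg v
    rw [vdeg] at this
    omega
  have m1 : IsMatchingOn G (G.edgeSet \ F) := by
    refine ⟨Set.sdiff_subset, ?_⟩
    intro e he f hf hef v hve hvf
    obtain ⟨a, ha⟩ := Set.ncard_eq_one.mp (hone v)
    have e1 : e ∈ ({a} : Set (Sym2 V)) := ha ▸ ⟨he, hve⟩
    have e2 : f ∈ ({a} : Set (Sym2 V)) := ha ▸ ⟨hf, hvf⟩
    exact hef (e1.trans e2.symm)
  have hM2F : M2 ⊆ F := fun e he => hEq ▸ Or.inl (Or.inl he)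
  have hM3F : M3 ⊆ F := fun e he => hEq ▸ Or.inl (Or.inr he)
  have hM4F : M4 ⊆ F := fun e he => hEq ▸ Or.inr he
  have dF : Disjoint (G.edgeSet \ F) F := Set.disjoint_sdiff_left
  -- the graph formed by the first two matchings
  let H := SimpleGraph.fromEdgeSet ((G.edgeSet \ F) ∪ M2)
  have hsubG : (G.edgeSet \ F) ∪ M2 ⊆ G.edgeSet := Set.union_subset m1.1 m2.1
  have hHe : H.edgeSet = (G.edgeSet \ F) ∪ M2 := by
    rw [SimpleGraph.edgeSet_fromEdgeSet]
    refine sdiff_eq_left.mpr (Set.disjoint_left.mpr fun e he hd => ?_)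
    exact G.not_isDiag_of_mem_edgeSet (hsubG he) hd
  have hHdeg : ∀ v, (H.neighborSet v).ncard = 1 + {e ∈ M2 | v ∈ e}.ncard := by
    intro v
    rw [← ncard_inc, hHe, ← hone v, ← Set.ncard_union_eq]
    · congr 1
      ext e
      simp only [Set.mem_setOf_eq, Set.mem_union]
      tauto
    · exact Set.disjoint_left.mpr fun e he he' => Set.disjoint_left.mp dF he.1 (hM2F he'.1)
  have hcOdd : Odd c.supp.ncard := by
    have : c ∈ oddComps F := by rw [hcc]; simp
    exact this
  have hx : Odd (H.neighborSet (r c)).ncard := by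
    have h0 : {e ∈ M2 | r c ∈ e} = ∅ := by
      ext e
      simp only [Set.mem_setOf_eq, Set.mem_empty_iff_false, iff_false]
      rintro ⟨h1, h2⟩
      exact (hcov c (r c) (hr c)).1 ⟨e, h1, h2⟩ ⟨rfl, hcOdd⟩
    rw [hHdeg, h0]
    simp
  have ho : ∀ v, Odd (H.neighborSet v).ncard → v = r c ∨ v = r c' := by
    intro v hv
    by_cases hm : ∃ e ∈ M2, v ∈ e
    · obtain ⟨e, he, hve⟩ := hm
      have h1 : {e ∈ M2 | v ∈ e} = {e} := by
        ext f
        simp only [Set.mem_setOf_eq, Set.mem_singleton_iff]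
        constructor
        · rintro ⟨hf, hvf⟩
          by_contra hfe
          exact m2.2 f hf e he hfe v hvf hve
        · rintro rfl
          exact ⟨he, hve⟩
      rw [hHdeg, h1, Set.ncard_singleton] at hv
      exact absurd hv (by decide)
    · have hv' := (hcov _ v rfl).not.mp hm
      push Not at hv'
      have : (SimpleGraph.fromEdgeSet F).connectedComponentMk v ∈ oddComps F := hv'.2
      rw [hcc] at this
      rcases this with h | h
      · left; rw [← h]; exact hv'.1
      · right
        have h : (SimpleGraph.fromEdgeSet F).connectedComponentMk v = c' := h
        rw [← h]; exact hv'.1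
  have hreach := reach_of_odd H (r c) (r c') hx ho
  obtain ⟨u, u', hu, hu', P, hP, hPs⟩ := shortest H c.supp c'.supp _ _ (hr c) (hr c') hreach
  have hle : H ≤ G := by
    rw [← SimpleGraph.edgeSet_subset_edgeSet, hHe]
    exact hsubG
  subst hEq
  refine ⟨G.edgeSet \ (M2 ∪ M3 ∪ M4), M2, M3, M4, m1, m2, m3, m4, dF.mono_right hM2F, dF.mono_right hM3F,
    dF.mono_right hM4F, d23, d24, d34, ?_, ?_, hF, c, c', hne, hcc, u, u', hu, hu',
    P.mapLe hle, ?_, ?_, ?_⟩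
  · rw [Set.union_assoc, Set.union_assoc, ← Set.union_assoc M2]
    exact Set.sdiff_union_of_subset hF.1
  · intro v
    obtain ⟨e, he⟩ := Set.nonempty_of_ncard_ne_zero (s := {e ∈ G.edgeSet \ (M2 ∪ M3 ∪ M4) | v ∈ e})
      (by rw [hone v]; decide)
    exact ⟨e, he.1, he.2⟩
  · exact (SimpleGraph.Walk.mapLe_isPath hle).2 hP
  · intro e he
    rw [SimpleGraph.Walk.edges_mapLe_eq_edges] at he
    have := P.edges_subset_edgeSet he
    rwa [hHe] at this
  · intro w hw
    rw [SimpleGraph.Walk.support_mapLe_eq_support] at hw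
    exact hPs w hw
end
end

section
/- Every bipartite 3-regular graph on n vertices admits a straight-line RAC drawing of O(n²) area. -/
open scoped Classical

noncomputable section

open Equiv

def Btwn (a p b : ℝ) : Prop := (a < p ∧ p < b) ∨ (b < p ∧ p < a) ∨ (a = p ∧ p = b)

lemma seg_param {a b p : Pt} (h : p ∈ segment ℝ a b) :
    ∃ t : ℝ, 0 ≤ t ∧ t ≤ 1 ∧ p.1 = a.1 + t * (b.1 - a.1) ∧ p.2 = a.2 + t * (b.2 - a.2) := by
  rw [segment_eq_image'] at h
  obtain ⟨t, ⟨h0, h1⟩, rfl⟩ := h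
  exact ⟨t, h0, h1, by simp, by simp⟩

lemma btw_of_param {a b t : ℝ} (h0 : 0 < t) (h1 : t < 1) : Btwn a (a + t * (b - a)) b := by
  unfold Btwn
  rcases lt_trichotomy a b with h | h | h
  · left; constructor <;> nlinarith
  · subst h; right; right; simp
  · right; left; constructor <;> nlinarith

lemma seg_cases {a b p : Pt} (h : p ∈ segment ℝ a b) :
    (p.1 = a.1 ∧ p.2 = a.2) ∨ (p.1 = b.1 ∧ p.2 = b.2) ∨ (Btwn a.1 p.1 b.1 ∧ Btwn a.2 p.2 b.2) := by
  obtain ⟨t, h0, h1, e1, e2⟩ := seg_param h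
  rcases h0.eq_or_lt with rfl | h0
  · left; constructor <;> simp [e1, e2]
  rcases h1.eq_or_lt with rfl | h1
  · right; left; constructor <;> simp [e1, e2]
  · right; right; rw [e1, e2]; exact ⟨btw_of_param h0 h1, btw_of_param h0 h1⟩

/-- Order condition for the columns. -/
def Half {E : Type} (σ τ : Perm E) (r : E) (x y : E → ℝ) : Prop :=
  ∀ s, s ≠ r → (x (σ⁻¹ s) < x s ∧ ∀ e, ¬ (x (σ⁻¹ s) < x e ∧ x e < x s)) ∨
    (x s < x (σ⁻¹ s) ∧ y (τ⁻¹ s) < y s ∧ (∀ e, ¬ (y (τ⁻¹ s) < y e ∧ y e < y s)) ∧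
      (∀ e, x s ≤ x e → x e ≤ x (σ⁻¹ s) → Perm.SameCycle σ s e) ∧
      ∀ e, Perm.SameCycle σ s e → y s ≤ y e)

/-- Two drawn edges meet only in a common endpoint or orthogonally. -/
def Qr {E : Type} (pw pb : E → Pt) (e f e' f' : E) : Prop :=
  ∀ p, p ∈ segment ℝ (pw e) (pb f) → p ∈ segment ℝ (pw e') (pb f') →
    (e = e' ∧ p = pw e) ∨ (f = f' ∧ p = pb f) ∨ SegOrth (pw e) (pb f) (pw e') (pb f')

lemma Qr.symm {E : Type} {pw pb : E → Pt} {e f e' f' : E} (h : Qr pw pb e f e' f') :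
    Qr pw pb e' f' e f := by
  intro p hp hp'
  rcases h p hp' hp with ⟨h1, h2⟩ | ⟨h1, h2⟩ | h1
  · left; exact ⟨h1.symm, h1 ▸ h2⟩
  · right; left; exact ⟨h1.symm, h1 ▸ h2⟩
  · right; right; unfold SegOrth at *; linarith

/-- A good drawing of the bipartite graph given by the relation `R` (white, black). -/
structure Gd {E : Type} (R : E → E → Prop) (pw pb : E → Pt) : Prop where
  injw : Function.Injective pw
  injb : Function.Injective pb
  wb : ∀ e f, pw e ≠ pb f
  nw : ∀ e, ∃ f f', R e f ∧ R e f' ∧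
    ((pb f).1 - (pw e).1) * ((pb f').2 - (pw e).2) ≠ ((pb f).2 - (pw e).2) * ((pb f').1 - (pw e).1)
  nb : ∀ f, ∃ e e', R e f ∧ R e' f ∧
    ((pw e).1 - (pb f).1) * ((pw e').2 - (pb f).2) ≠ ((pw e).2 - (pb f).2) * ((pw e').1 - (pb f).1)
  q : ∀ e f e' f', R e f → R e' f' → (e ≠ e' ∨ f ≠ f') → Qr pw pb e f e' f'

def EdgeRel {E : Type} (σ τ : Perm E) (e f : E) : Prop := f = e ∨ f = σ e ∨ f = τ e

section geom
variable {E : Type} {σ τ : Perm E} {r : E} {x y : E → ℝ}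

/-- diagonal versus vertical -/
lemma dv (hx : Function.Injective x) (hy : Function.Injective y)
    (P1 : Half σ τ r x y) (P2 : Half τ σ r y x) (yr : ∀ e, y r ≤ y e)
    {e e' : E} (he : e ≠ r) {YB : ℝ} (hYB : σ e' ≠ r → YB = y (τ⁻¹ (σ e')))
    {px py : ℝ}
    (hD : (px = x e ∧ py = y e) ∨ (px = x (σ⁻¹ e) ∧ py = y (τ⁻¹ e)) ∨
      (Btwn (x e) px (x (σ⁻¹ e)) ∧ Btwn (y e) py (y (τ⁻¹ e))))
    (hV : px = x e') (hV' : py = y e' ∨ py = YB ∨ Btwn (y e') py YB) :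
    (e = e' ∧ px = x e ∧ py = y e) ∨ (e = σ e' ∧ px = x (σ⁻¹ e) ∧ py = y (τ⁻¹ e)) := by
  rcases hD with h | h | ⟨h1, h2⟩
  · left; exact ⟨hx (h.1 ▸ hV), h⟩
  · right; refine ⟨?_, h⟩
    have := hx (h.1 ▸ hV); rw [← this]; simp
  · exfalso
    rcases P1 e he with ⟨a, b⟩ | ⟨a, b, c, d, f⟩
    · apply b e'; unfold Btwn at h1; grind
    · have h1' : x e < x e' ∧ x e' < x (σ⁻¹ e) := by unfold Btwn at h1; grind
      have h2' : py < y e := by unfold Btwn at h2; grind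
      have sc := d e' h1'.1.le h1'.2.le
      have k1 := f e' sc
      have sc2 : Perm.SameCycle σ e (σ e') := Perm.sameCycle_apply_right.2 sc
      have k2 := f _ sc2
      have ne1 : σ e' ≠ e := by
        intro h; have : e' = σ⁻¹ e := by rw [← h]; simp
        rw [this] at h1'; exact lt_irrefl _ h1'.2
      have ne2 : σ e' ≠ r := by
        intro h; rw [h] at k2; exact he (hy (le_antisymm k2 (yr e)))
      have k3 : y e < y (σ e') := lt_of_le_of_ne k2 (fun h => ne1 (hy h).symm)
      have k4 : y e ≤ YB := by
        rw [hYB ne2]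
        rcases P2 _ ne2 with ⟨a', b'⟩ | ⟨a', _⟩
        · by_contra hh; exact b' e ⟨not_le.1 hh, k3⟩
        · linarith
      unfold Btwn at hV'
      grind

lemma end_top {ue se ve te pu pv : ℝ} (a : se < ue)
    (h : (pu = ue ∧ pv = ve) ∨ (pu = se ∧ pv = te) ∨ (Btwn ue pu se ∧ Btwn ve pv te)) :
    se ≤ pu ∧ pu ≤ ue ∧ (pu = ue → pv = ve) ∧ (pu = se → pv = te) := by
  unfold Btwn at h
  refine ⟨?_, ?_, ?_, ?_⟩ <;> grind

lemma dd_cons {ue se ue' se' ve te ve' te' pu pv : ℝ} (a : se < ue) (a' : se' < ue')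
    (n : ue ≠ ue') (c : ¬ (se < ue' ∧ ue' < ue)) (c' : ¬ (se' < ue ∧ ue < ue'))
    (m : ¬ (ue = se' ∧ ve = te')) (m' : ¬ (ue' = se ∧ ve' = te))
    (h : (pu = ue ∧ pv = ve) ∨ (pu = se ∧ pv = te) ∨ (Btwn ue pu se ∧ Btwn ve pv te))
    (h' : (pu = ue' ∧ pv = ve') ∨ (pu = se' ∧ pv = te') ∨ (Btwn ue' pu se' ∧ Btwn ve' pv te')) :
    False := by
  obtain ⟨h1, h2, h3, h4⟩ := end_top a h
  obtain ⟨h1', h2', h3', h4'⟩ := end_top a' h'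
  rcases lt_or_gt_of_ne n with hl | hl
  · have : ue ≤ se' := by by_contra hh; exact c' ⟨not_le.1 hh, hl⟩
    have e1 : pu = ue := by linarith
    have e2 : pu = se' := by linarith
    exact m ⟨by linarith, by rw [← h3 e1, ← h4' e2]⟩
  · have : ue' ≤ se := by by_contra hh; exact c ⟨not_le.1 hh, hl⟩
    have e1 : pu = ue' := by linarith
    have e2 : pu = se := by linarith
    exact m' ⟨by linarith, by rw [← h3' e1, ← h4 e2]⟩

lemma dd_key {xe xe' sx sx' ye ye' ty ty' px py : ℝ} (n2 : ye ≠ ye') (n3 : sx ≠ sx') (a1 : xe < sx)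
    (a2 : ty < ye) (a3 : xe ≤ xe' → xe' ≤ sx → ye ≤ ye') (b1 : sx' < xe') (b2 : ye' < ty')
    (b4 : ¬ (sx' < sx ∧ sx < xe'))
    (h : (px = xe ∧ py = ye) ∨ (px = sx ∧ py = ty) ∨ (Btwn xe px sx ∧ Btwn ye py ty))
    (h' : (px = xe' ∧ py = ye') ∨ (px = sx' ∧ py = ty') ∨ (Btwn xe' px sx' ∧ Btwn ye' py ty')) :
    False := by
  have p1 : xe ≤ px ∧ px ≤ sx ∧ py ≤ ye := by
    unfold Btwn at h
    refine ⟨?_, ?_, ?_⟩ <;> grind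
  have p2 : sx' ≤ px ∧ px ≤ xe' ∧ ye' ≤ py := by
    unfold Btwn at h'
    refine ⟨?_, ?_, ?_⟩ <;> grind
  by_cases h1 : xe' ≤ sx
  · have := a3 (by linarith) h1
    exact n2 (by linarith)
  · apply n3
    by_contra hne
    apply b4
    exact ⟨lt_of_le_of_ne (by linarith) (Ne.symm hne), not_le.1 h1⟩

lemma dd (hx : Function.Injective x) (hy : Function.Injective y)
    (P1 : Half σ τ r x y) (P2 : Half τ σ r y x)
    {e e' : E} (he : e ≠ r) (he' : e' ≠ r) (hee : e ≠ e')
    (hd : ∀ e f, ¬ (x e = x (σ⁻¹ f) ∧ y e = y (τ⁻¹ f)))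
    {px py : ℝ}
    (hD : (px = x e ∧ py = y e) ∨ (px = x (σ⁻¹ e) ∧ py = y (τ⁻¹ e)) ∨
      (Btwn (x e) px (x (σ⁻¹ e)) ∧ Btwn (y e) py (y (τ⁻¹ e))))
    (hD' : (px = x e' ∧ py = y e') ∨ (px = x (σ⁻¹ e') ∧ py = y (τ⁻¹ e')) ∨
      (Btwn (x e') px (x (σ⁻¹ e')) ∧ Btwn (y e') py (y (τ⁻¹ e')))) : False := by
  have n1 : x e ≠ x e' := fun h => hee (hx h)
  have n2 : y e ≠ y e' := fun h => hee (hy h)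
  have n3 : x (σ⁻¹ e) ≠ x (σ⁻¹ e') := fun h => hee (σ⁻¹.injective (hx h))
  have n4 : y (τ⁻¹ e) ≠ y (τ⁻¹ e') := fun h => hee (τ⁻¹.injective (hy h))
  have m1 := hd e e'
  have m2 := hd e' e
  have hF : (py = y e ∧ px = x e) ∨ (py = y (τ⁻¹ e) ∧ px = x (σ⁻¹ e)) ∨
      (Btwn (y e) py (y (τ⁻¹ e)) ∧ Btwn (x e) px (x (σ⁻¹ e))) :=
    hD.imp And.symm (Or.imp And.symm And.symm)
  have hF' : (py = y e' ∧ px = x e') ∨ (py = y (τ⁻¹ e') ∧ px = x (σ⁻¹ e')) ∨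
      (Btwn (y e') py (y (τ⁻¹ e')) ∧ Btwn (x e') px (x (σ⁻¹ e'))) :=
    hD'.imp And.symm (Or.imp And.symm And.symm)
  have m1' : ¬ (y e = y (τ⁻¹ e') ∧ x e = x (σ⁻¹ e')) := fun h => m1 h.symm
  have m2' : ¬ (y e' = y (τ⁻¹ e) ∧ x e' = x (σ⁻¹ e)) := fun h => m2 h.symm
  rcases P1 e he with ⟨a1, a2⟩ | ⟨a1, a2, a3, a4, a5⟩ <;>
  rcases P1 e' he' with ⟨b1, b2⟩ | ⟨b1, b2, b3, b4, b5⟩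
  · exact dd_cons a1 b1 n1 (a2 _) (b2 _) m1 m2 hD hD'
  · rcases P2 e he with ⟨c1, c2⟩ | ⟨c1, c2, c3, c4, c5⟩
    · exact dd_cons c1 b2 n2 (c2 _) (b3 _) m1' m2' hF hF'
    · exact dd_key n2.symm n3.symm b1 b2 (fun h1 h2 => b5 _ (b4 _ h1 h2)) a1 c1 (a2 _) hD' hD
  · rcases P2 e' he' with ⟨c1, c2⟩ | ⟨c1, c2, c3, c4, c5⟩
    · exact dd_cons a2 c1 n2 (a3 _) (c2 _) m1' m2' hF hF'
    · exact dd_key n2 n3 a1 a2 (fun h1 h2 => a5 _ (a4 _ h1 h2)) b1 c1 (b2 _) hD hD'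
  · exact dd_cons a2 b2 n2 (a3 _) (b3 _) m1' m2' hF hF'

end geom

lemma perm_inv_self {E : Type} (τ : Perm E) (e : E) : τ⁻¹ (τ e) = e := by simp

lemma sc_inv_right {E : Type} {τ : Perm E} {e f : E} (h : Perm.SameCycle τ e (τ⁻¹ f)) :
    Perm.SameCycle τ e f := by
  have := Perm.sameCycle_apply_right.2 h
  simpa using this

section geomtwo
variable {E : Type} {σ τ : Perm E} {r : E} {x y : E → ℝ} {N m : ℝ}

structure Cfg (σ τ : Perm E) (r : E) (x y : E → ℝ) (N m : ℝ) : Prop where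
  hx : Function.Injective x
  hy : Function.Injective y
  P1 : Half σ τ r x y
  P2 : Half τ σ r y x
  hσ : ∀ e, σ e ≠ e
  hτ : ∀ e, τ e ≠ e
  hστ : ∀ e, σ e ≠ τ e
  xr : x r = 0
  x0 : ∀ e, 0 ≤ x e
  xN : ∀ e, x e ≤ N - 1
  yr : y r = -2 * N
  y0 : ∀ e, e ≠ r → 0 ≤ y e
  yN : ∀ e, y e ≤ N - 1
  hN : 1 ≤ N
  hm : (m = y (τ⁻¹ r) ∧ x (σ⁻¹ r) < x (τ⁻¹ r)) ∨ (m = y (τ⁻¹ r) + 1 ∧ ∀ e, y e ≤ y (τ⁻¹ r))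

def PW (r : E) (x y : E → ℝ) (N m : ℝ) (e : E) : Pt := if e = r then (-2 * N, m) else (x e, y e)
def PB (σ τ : Perm E) (r : E) (x y : E → ℝ) (m : ℝ) (f : E) : Pt :=
  (x (σ⁻¹ f), if f = r then m else y (τ⁻¹ f))

local notation "pw" => PW r x y N m
local notation "pb" => PB σ τ r x y m

lemma PW_r : pw r = (-2 * N, m) := by simp [PW]
lemma PW_ne {e : E} (h : e ≠ r) : pw e = (x e, y e) := by simp [PW, h]
lemma PB_r : pb r = (x (σ⁻¹ r), m) := by simp [PB]
lemma PB_ne {e : E} (h : e ≠ r) : pb e = (x (σ⁻¹ e), y (τ⁻¹ e)) := by simp [PB, h]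
lemma PB_fst (e : E) : (pb e).1 = x (σ⁻¹ e) := by simp [PB]
lemma PB_σ (e : E) : (pb (σ e)).1 = x e := by simp [PB]

namespace Cfg

lemma sr (C : Cfg σ τ r x y N m) : σ⁻¹ r ≠ r := fun h => C.hσ r (by
    conv_lhs => rw [← h]
    simp)
lemma tr (C : Cfg σ τ r x y N m) : τ⁻¹ r ≠ r := fun h => C.hτ r (by
    conv_lhs => rw [← h]
    simp)
lemma sne (C : Cfg σ τ r x y N m) (e : E) : σ⁻¹ e ≠ e := fun h => C.hσ e (by
    conv_lhs => rw [← h]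
    simp)
lemma tne (C : Cfg σ τ r x y N m) (e : E) : τ⁻¹ e ≠ e := fun h => C.hτ e (by
    conv_lhs => rw [← h]
    simp)
lemma stne (C : Cfg σ τ r x y N m) (e : E) : σ⁻¹ e ≠ τ⁻¹ e := fun h => C.hστ (σ⁻¹ e) (by
    conv_rhs => rw [h]
    simp)
lemma m0 (C : Cfg σ τ r x y N m) : 0 ≤ m := by
  have := C.y0 _ C.tr
  rcases C.hm with h | h <;> linarith [h.1]
lemma mN (C : Cfg σ τ r x y N m) : m ≤ N := by
  have := C.yN (τ⁻¹ r)
  rcases C.hm with h | h <;> linarith [h.1]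
lemma xpos (C : Cfg σ τ r x y N m) {e : E} (h : e ≠ r) : 0 < x e :=
  lt_of_le_of_ne (C.x0 e) (fun h' => h (C.hx (by rw [← h', C.xr])))
lemma row (C : Cfg σ τ r x y N m) {f : E} (h : f ≠ τ⁻¹ r) : y f ≠ m := by
  rcases C.hm with h' | h'
  · rw [h'.1]; exact fun h1 => h (C.hy h1)
  · have := h'.2 f; intro h2; linarith [h'.1]
lemma row' (C : Cfg σ τ r x y N m) {f : E} (h : f ≠ r) : y (τ⁻¹ f) ≠ m := C.row (fun h' => h (τ⁻¹.injective h'))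
lemma y0' (C : Cfg σ τ r x y N m) {f : E} (h : f ≠ τ r) : 0 ≤ y (τ⁻¹ f) := C.y0 _ (fun h' => h (by rw [← h']; simp))

lemma hd (C : Cfg σ τ r x y N m) (e f : E) : ¬ (x e = x (σ⁻¹ f) ∧ y e = y (τ⁻¹ f)) := by
  rintro ⟨h1, h2⟩
  exact C.stne f ((C.hx h1).symm.trans (C.hy h2))

lemma wb (C : Cfg σ τ r x y N m) (e f : E) : pw e ≠ pb f := by
  intro h
  have h1 := congrArg Prod.fst h
  have h2 := congrArg Prod.snd h
  by_cases he : e = r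
  · subst he
    rw [PW_r, PB_fst] at h1
    have := C.x0 (σ⁻¹ f)
    have := C.hN
    simp only at h1; linarith
  · rw [PW_ne he] at h1 h2
    rw [PB_fst] at h1
    simp only at h1 h2
    by_cases hf : f = r
    · subst hf
      rw [PB_r] at h2
      have h3 := C.hx h1
      exact C.row (by rw [h3]; exact C.stne _) h2
    · rw [PB_ne hf] at h2
      exact C.hd e f ⟨h1, h2⟩

lemma left_row (C : Cfg σ τ r x y N m) (f' : E) : 0 ≤ (pb f').1 := by rw [PB_fst]; exact C.x0 _

lemma q1 (C : Cfg σ τ r x y N m) {e' f' : E} (he : e' ≠ r) : Qr pw pb r (σ r) e' f' := by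
  intro p hp hp'
  right; left
  have h1 := seg_cases hp
  have h2 := seg_cases hp'
  rw [PW_r, PB_σ] at h1
  rw [PW_ne he] at h2
  have a1 := C.xpos he
  have a2 := C.x0 (σ⁻¹ f')
  have a3 := C.hN
  have a4 := C.xr
  rw [PB_fst] at h2
  simp only at h1 h2
  have b1 : p.1 ≤ 0 ∧ (p.1 = 0 → p.2 = (pb (σ r)).2) := by
    unfold Btwn at h1
    constructor <;> grind
  have b2 : 0 ≤ p.1 ∧ (p.1 = 0 → x (σ⁻¹ f') = 0) := by
    unfold Btwn at h2
    constructor <;> grind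
  have b3 : p.1 = 0 := le_antisymm b1.1 b2.1
  have b4 := b2.2 b3
  refine ⟨?_, Prod.ext ?_ (b1.2 b3)⟩
  · rw [← C.xr] at b4
    rw [← C.hx b4]; simp
  · rw [PB_σ, b3, C.xr]

lemma q2 (C : Cfg σ τ r x y N m) {e' f' : E} (he : e' ≠ r) : Qr pw pb r (τ r) e' f' := by
  intro p hp hp'
  have a0 := C.hN
  have a1 := C.m0
  have a2 := C.mN
  have a3 := C.y0 _ he
  have a4 := C.x0 e'
  have b0 := C.x0 (σ⁻¹ (τ r))
  have bN := C.xN (σ⁻¹ (τ r))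
  by_cases hf : f' = τ r
  · subst hf
    right; left
    refine ⟨rfl, ?_⟩
    rw [segment_symm] at hp hp'
    obtain ⟨t, t0, t1, t2, t3⟩ := seg_param hp
    obtain ⟨s, s0, s1, s2, s3⟩ := seg_param hp'
    rw [PW_r, PB_ne (C.hτ r)] at t2 t3
    rw [PW_ne he, PB_ne (C.hτ r)] at s2 s3
    simp only [perm_inv_self, C.yr] at s2 s3 t2 t3
    set β := x (σ⁻¹ (τ r))
    have k1 : s * β ≤ s * (N - 1) := by gcongr
    have k2 : 0 ≤ s * x e' := by positivity
    have k3 : 0 ≤ t * β := by positivity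
    have k4 : 0 ≤ s * y e' := by positivity
    have k5 : t * m ≤ t * N := by gcongr
    have k6 : t * 1 ≤ t * N := by gcongr
    have ht : t = 0 := by
      nlinarith
    rw [ht] at t2 t3
    rw [PB_ne (C.hτ r)]
    apply Prod.ext
    · simp only; linarith
    · simp only [perm_inv_self, C.yr]; linarith
  · exfalso
    obtain ⟨t, t0, t1, t2, t3⟩ := seg_param hp
    rw [PW_r, PB_ne (C.hτ r)] at t2 t3
    simp only [perm_inv_self, C.yr] at t2 t3
    have h2 := seg_cases hp'
    have c1 : 0 ≤ (pb f').1 := C.left_row f'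
    have c2 : 0 ≤ (pb f').2 := by
      by_cases h : f' = r
      · rw [h, PB_r]; exact a1
      · rw [PB_ne h]; exact C.y0' hf
    rw [PW_ne he] at h2
    simp only at h2
    have d1 : 0 ≤ p.1 := by unfold Btwn at h2; grind
    have d2 : 0 ≤ p.2 := by unfold Btwn at h2; grind
    set β := x (σ⁻¹ (τ r))
    have k1 : t * β ≤ t * (N - 1) := by gcongr
    have k5 : m * (1 - t) ≤ N * (1 - t) := mul_le_mul_of_nonneg_right a2 (by linarith)
    nlinarith

lemma q3 (C : Cfg σ τ r x y N m) {e' f' : E} (he : e' ≠ r) (hR : EdgeRel σ τ e' f') : Qr pw pb r r e' f' := by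
  intro p hp hp'
  have a0 := C.hN
  have h1 := seg_cases hp
  have h2 := seg_cases hp'
  rw [PW_r, PB_r] at h1
  have a1 := C.x0 (σ⁻¹ r)
  simp only at h1
  have b1 : p.2 = m ∧ p.1 ≤ x (σ⁻¹ r) := by
    unfold Btwn at h1
    constructor <;> grind
  rcases hR with rfl | rfl | rfl
  · exfalso
    rw [PW_ne he, PB_ne he] at h2
    simp only at h2
    rcases C.hm with ⟨hm, hm'⟩ | ⟨hm, hm'⟩
    · rcases h2 with h2 | h2 | h2
      · have : y f' = y (τ⁻¹ r) := by linarith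
        rw [C.hy this] at h2; linarith
      · exact C.row' he (by linarith)
      · have h3 := h2.2
        rw [b1.1] at h3
        rcases C.P2 f' he with ⟨c1, c2⟩ | ⟨c1, c2, c3, c4, c5⟩
        · apply c2 (τ⁻¹ r); unfold Btwn at h3; grind
        · have h4 := c4 (τ⁻¹ r) (by unfold Btwn at h3; grind) (by unfold Btwn at h3; grind)
          have h5 := c5 r (sc_inv_right h4)
          have := C.xpos he
          linarith [C.xr]
    · have := hm' f'
      have := hm' (τ⁻¹ f')
      unfold Btwn at h2; grind
  · right; right
    unfold SegOrth
    rw [PB_σ, PW_ne he, PW_r, PB_r]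
    simp
  · rw [PW_ne he] at h2
    by_cases hr : τ e' = r
    · have hc : e' = τ⁻¹ r := by rw [← hr]; simp
      right; left
      refine ⟨hr.symm, ?_⟩
      rw [hr, PB_r] at h2
      rw [PB_r]
      simp only at h2
      rcases C.hm with ⟨hm, hm'⟩ | ⟨hm, hm'⟩
      · rw [← hc] at hm hm'
        apply Prod.ext
        · simp only; unfold Btwn at h2; grind
        · exact b1.1
      · rw [← hc] at hm hm'
        apply Prod.ext
        · simp only; unfold Btwn at h2; grind
        · exact b1.1
    · exfalso
      rw [PB_ne hr] at h2
      simp only [perm_inv_self] at h2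
      have : y e' ≠ m := C.row (fun h => hr (by rw [h]; simp))
      unfold Btwn at h2; grind

lemma q4 (C : Cfg σ τ r x y N m) {f : E} (hf : f ≠ r) : Qr pw pb r r r f := by
  intro p hp hp'
  left
  refine ⟨rfl, ?_⟩
  have h1 := seg_cases hp
  have h2 := seg_cases hp'
  have h3 := C.row' hf
  rw [PW_r, PB_ne hf] at h2
  rw [PW_r, PB_r] at h1
  rw [PW_r]
  simp only at h1 h2
  have : p.2 = m := by unfold Btwn at h1; grind
  rcases h2 with h2 | h2 | h2
  · exact Prod.ext h2.1 h2.2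
  · exfalso; exact h3 (by linarith)
  · exfalso; unfold Btwn at h2; grind

lemma q5 (C : Cfg σ τ r x y N m) : Qr pw pb r (σ r) r (τ r) := by
  intro p hp hp'
  left
  refine ⟨rfl, ?_⟩
  have a0 := C.hN
  have a1 := C.m0
  have a2 := C.mN
  have b0 := C.x0 (σ⁻¹ (τ r))
  have bN := C.xN (σ⁻¹ (τ r))
  obtain ⟨t, t0, t1, t2, t3⟩ := seg_param hp
  obtain ⟨s, s0, s1, s2, s3⟩ := seg_param hp'
  rw [PW_r, PB_ne (C.hσ r)] at t2 t3
  rw [PW_r, PB_ne (C.hτ r)] at s2 s3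
  simp only [perm_inv_self, C.yr, C.xr] at s2 s3 t2 t3
  have a3 : 0 ≤ y (τ⁻¹ (σ r)) := C.y0' (C.hστ r)
  set β := x (σ⁻¹ (τ r))
  set ya := y (τ⁻¹ (σ r))
  have k1 : s * β ≤ s * (N - 1) := by gcongr
  have k2 : 0 ≤ t * ya := by positivity
  have k3 : 0 ≤ s * m := by positivity
  have k5 : t * m ≤ t * N := by gcongr
  have k6 : s * 1 ≤ s * N := by gcongr
  have hs : s = 0 := by nlinarith
  rw [hs] at s2 s3
  rw [PW_r]
  exact Prod.ext (by simp only; linarith) (by simp only; linarith)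

lemma qVV (C : Cfg σ τ r x y N m) {e e' : E} (he : e ≠ r) (he' : e' ≠ r) (hne : e ≠ e') : Qr pw pb e (σ e) e' (σ e') := by
  intro p hp hp'
  exfalso
  have h1 := seg_cases hp
  have h2 := seg_cases hp'
  rw [PW_ne he, PB_σ] at h1
  rw [PW_ne he', PB_σ] at h2
  simp only at h1 h2
  have h3 : x e ≠ x e' := fun h => hne (C.hx h)
  unfold Btwn at h1 h2; grind

lemma hor (C : Cfg σ τ r x y N m) {e : E} (he : e ≠ r) (h : τ e ≠ r ∨ m = y (τ⁻¹ r)) : (pb (τ e)).2 = y e := by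
  by_cases hr : τ e = r
  · rw [hr, PB_r]
    have h' : m = y (τ⁻¹ r) := by tauto
    rw [← hr] at h'; rw [h']; simp
  · rw [PB_ne hr]; simp

lemma hor_seg (C : Cfg σ τ r x y N m) {e : E} (he : e ≠ r) (h : τ e ≠ r ∨ m = y (τ⁻¹ r)) {p : Pt}
    (hp : p ∈ segment ℝ (pw e) (pb (τ e))) : p.2 = y e := by
  have h1 := seg_cases hp
  rw [C.hor he h, PW_ne he] at h1
  simp only at h1
  unfold Btwn at h1; grind

lemma slant (C : Cfg σ τ r x y N m) {e : E} (he : e ≠ r) (hr : τ e = r) (hm : m = y (τ⁻¹ r) + 1) {p : Pt}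
    (hp : p ∈ segment ℝ (pw e) (pb (τ e))) : y e ≤ p.2 ∧ (p.2 = y e → p = pw e) ∧
      (p.1 = x (σ⁻¹ r) → p = pb r) := by
  have h1 := seg_cases hp
  have hc : e = τ⁻¹ r := by rw [← hr]; simp
  have hne : x e ≠ x (σ⁻¹ r) := fun h => C.stne r ((C.hx h).symm.trans hc)
  rw [hr, PB_r, PW_ne he] at h1
  rw [← hc] at hm
  rw [PW_ne he, PB_r, Prod.ext_iff, Prod.ext_iff]
  simp only at h1 ⊢
  unfold Btwn at h1
  refine ⟨?_, ?_, ?_⟩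
  · grind
  · grind
  · grind

lemma qHH (C : Cfg σ τ r x y N m) {e e' : E} (he : e ≠ r) (he' : e' ≠ r) (hne : e ≠ e') : Qr pw pb e (τ e) e' (τ e') := by
  wlog h : τ e' ≠ r ∨ m = y (τ⁻¹ r) generalizing e e' with H
  · have hr : τ e ≠ r := by
      intro hr; apply h; left; intro hr'; apply hne; apply τ.injective; rw [hr, hr']
    exact (H he' he hne.symm (Or.inl hr)).symm
  intro p hp hp'
  exfalso
  have h3 : y e ≠ y e' := fun h => hne (C.hy h)
  have h2 := C.hor_seg he' h hp'
  by_cases h' : τ e ≠ r ∨ m = y (τ⁻¹ r)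
  · exact h3 (by rw [← h2, C.hor_seg he h' hp])
  · push Not at h'
    rcases C.hm with hm | hm
    · exact h'.2 hm.1
    · have := C.slant he h'.1 hm.1 hp
      have hc : e = τ⁻¹ r := by rw [← h'.1]; simp
      have h4 := hm.2 e'
      rw [← hc] at h4
      apply h3; linarith

lemma qVH (C : Cfg σ τ r x y N m) {e e' : E} (he : e ≠ r) (he' : e' ≠ r) : Qr pw pb e (σ e) e' (τ e') := by
  intro p hp hp'
  by_cases h : τ e' ≠ r ∨ m = y (τ⁻¹ r)
  · right; right
    unfold SegOrth
    rw [PB_σ, C.hor he' h, PW_ne he, PW_ne he']; simp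
  · push Not at h
    rcases C.hm with hm | hm
    · exact absurd hm.1 h.2
    · obtain ⟨s1, s2, s3⟩ := C.slant he' h.1 hm.1 hp'
      have hc : e' = τ⁻¹ r := by rw [← h.1]; simp
      have h1 := seg_cases hp
      rw [PB_σ, PW_ne he] at h1
      simp only at h1
      have hpx : p.1 = x e := by unfold Btwn at h1; grind
      by_cases hr : σ e = r
      · right; left
        have : e = σ⁻¹ r := by rw [← hr]; simp
        rw [hr]; exact ⟨h.1.symm, s3 (by rw [hpx, this])⟩
      · left
        have h5 := hm.2 e
        have h6 := hm.2 (τ⁻¹ (σ e))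
        rw [← hc] at h5 h6
        rw [PB_ne hr] at h1
        simp only at h1
        have hpy : p.2 = y e' := by
          apply le_antisymm _ s1
          unfold Btwn at h1; grind
        have h7 := s2 hpy
        have h8 : e = e' := by
          apply C.hx; rw [← hpx, h7, PW_ne he']
        exact ⟨h8, by rw [h7, h8]⟩

lemma qDD (C : Cfg σ τ r x y N m) {e e' : E} (he : e ≠ r) (he' : e' ≠ r) (hne : e ≠ e') : Qr pw pb e e e' e' := by
  intro p hp hp'
  exfalso
  have h1 := seg_cases hp
  have h2 := seg_cases hp'
  rw [PW_ne he, PB_ne he] at h1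
  rw [PW_ne he', PB_ne he'] at h2
  exact dd C.hx C.hy C.P1 C.P2 he he' hne C.hd h1 h2

lemma yr' (C : Cfg σ τ r x y N m) (e : E) : y r ≤ y e := by
  by_cases h : e = r
  · rw [h]
  · have := C.y0 e h; have := C.hN; linarith [C.yr]

lemma qDV (C : Cfg σ τ r x y N m) {e e' : E} (he : e ≠ r) (he' : e' ≠ r) : Qr pw pb e e e' (σ e') := by
  intro p hp hp'
  have h1 := seg_cases hp
  have h2 := seg_cases hp'
  rw [PW_ne he, PB_ne he] at h1
  rw [PW_ne he', PB_σ] at h2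
  have := dv C.hx C.hy C.P1 C.P2 C.yr' he (e' := e') (YB := (pb (σ e')).2)
    (fun h => by rw [PB_ne h]) h1 (by simp only at h2; unfold Btwn at h2; grind)
    (by simp only at h2; tauto)
  rcases this with ⟨a, b, c⟩ | ⟨a, b, c⟩
  · left; exact ⟨a, by rw [PW_ne he]; exact Prod.ext b c⟩
  · right; left; exact ⟨a, by rw [PB_ne he]; exact Prod.ext b c⟩

lemma qDH (C : Cfg σ τ r x y N m) {e e' : E} (he : e ≠ r) (he' : e' ≠ r) : Qr pw pb e e e' (τ e') := by
  intro p hp hp'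
  have h1 := seg_cases hp
  rw [PW_ne he, PB_ne he] at h1
  by_cases h : τ e' ≠ r ∨ m = y (τ⁻¹ r)
  · have hpy := C.hor_seg he' h hp'
    have h2 := seg_cases hp'
    rw [PW_ne he'] at h2
    have := dv C.hy C.hx C.P2 C.P1 (fun e => by rw [C.xr]; exact C.x0 e) he (e' := e')
      (YB := (pb (τ e')).1) (fun h => by rw [PB_fst]) (px := p.2) (py := p.1)
      (h1.imp And.symm (Or.imp And.symm And.symm)) hpy
      (h2.imp And.left (Or.imp And.left And.left))
    rcases this with ⟨a, b, c⟩ | ⟨a, b, c⟩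
    · left; exact ⟨a, by rw [PW_ne he]; exact Prod.ext c b⟩
    · right; left; exact ⟨a, by rw [PB_ne he]; exact Prod.ext c b⟩
  · push Not at h
    rcases C.hm with hm | hm
    · exact absurd hm.1 h.2
    · obtain ⟨s1, s2, s3⟩ := C.slant he' h.1 hm.1 hp'
      have hc : e' = τ⁻¹ r := by rw [← h.1]; simp
      have h5 := hm.2 e
      have h6 := hm.2 (τ⁻¹ e)
      rw [← hc] at h5 h6
      simp only at h1
      have hpy : p.2 = y e' := by
        apply le_antisymm _ s1
        unfold Btwn at h1; grind
      have h7 := s2 hpy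
      left
      rcases h1 with h1 | h1 | h1
      · have h8 : e = e' := by apply C.hy; rw [← hpy, h1.2]
        exact ⟨h8, by rw [h7, h8]⟩
      · exfalso
        apply C.wb e' e
        rw [← h7, PB_ne he]; exact Prod.ext h1.1 h1.2
      · exfalso
        have := h1.2
        have h9 : y e ≠ y (τ⁻¹ e) := fun h => C.tne e (C.hy h).symm
        unfold Btwn at this
        grind

lemma gd (C : Cfg σ τ r x y N m) : Gd (EdgeRel σ τ) pw pb where
  injw := by
    intro e f h
    have a0 := C.hN
    have h1 := congrArg Prod.fst h
    by_cases he : e = r <;> by_cases hf : f = r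
    · rw [he, hf]
    · rw [he, PW_r, PW_ne hf] at h1
      have := C.x0 f; simp only at h1; linarith
    · rw [hf, PW_r, PW_ne he] at h1
      have := C.x0 e; simp only at h1; linarith
    · rw [PW_ne hf, PW_ne he] at h1
      exact C.hx h1
  injb := by
    intro e f h
    have h1 := congrArg Prod.fst h
    rw [PB_fst, PB_fst] at h1
    exact σ⁻¹.injective (C.hx h1)
  wb := C.wb
  nw := by
    intro e
    have a0 := C.hN
    by_cases he : e = r
    · subst he
      refine ⟨σ e, e, by simp [EdgeRel], by simp [EdgeRel], ?_⟩
      rw [PW_r, PB_r, PB_ne (C.hσ e)]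
      have h1 := C.row' (C.hσ e)
      have h2 := C.x0 (σ⁻¹ e)
      simp only [sub_self, mul_zero]
      apply Ne.symm
      apply mul_ne_zero
      · exact sub_ne_zero.2 h1
      · intro h; linarith
    · refine ⟨σ e, e, by simp [EdgeRel], by simp [EdgeRel], ?_⟩
      have h1 := C.wb e (σ e)
      rw [PB_fst e, PB_σ]
      have h2 : (pw e).1 = x e := by rw [PW_ne he]
      rw [h2, sub_self, zero_mul]
      apply Ne.symm
      apply mul_ne_zero
      · rw [sub_ne_zero]
        intro h; apply h1; apply Prod.ext
        · rw [h2, PB_σ]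
        · exact h.symm
      · exact sub_ne_zero.2 (fun h => C.sne e (C.hx h))
  nb := by
    intro f
    have a0 := C.hN
    by_cases hf : σ⁻¹ f = r
    · have hf' : f = σ r := by rw [← hf]; simp
      subst hf'
      refine ⟨r, τ⁻¹ (σ r), by simp [EdgeRel], by simp [EdgeRel], ?_⟩
      have h1 : τ⁻¹ (σ r) ≠ r := fun h => C.hστ r (by
        have := congrArg τ h
        simpa using this)
      have h2 := C.xpos h1
      have h3 := C.row' (C.hσ r)
      rw [PW_r, PB_ne (C.hσ r), PW_ne h1]
      simp only [perm_inv_self, C.xr, sub_self, mul_zero, sub_zero]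
      apply Ne.symm
      apply mul_ne_zero _ h2.ne'
      exact sub_ne_zero.2 h3.symm
    · refine ⟨σ⁻¹ f, τ⁻¹ f, by simp [EdgeRel], by simp [EdgeRel], ?_⟩
      have h1 := C.wb (σ⁻¹ f) f
      have h2 : (pw (σ⁻¹ f)).1 = x (σ⁻¹ f) := by rw [PW_ne hf]
      rw [PB_fst f, h2, sub_self, zero_mul]
      apply Ne.symm
      apply mul_ne_zero
      · rw [sub_ne_zero]
        intro h; apply h1; apply Prod.ext
        · rw [h2, PB_fst]
        · exact h
      · rw [sub_ne_zero]
        by_cases ht : τ⁻¹ f = r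
        · rw [ht, PW_r]
          have := C.x0 (σ⁻¹ f)
          simp only; intro h; linarith
        · rw [PW_ne ht]
          exact fun h => C.stne f (C.hx h).symm
  q := by
    intro e f e' f' hR hR' hne
    have key : ∀ e f e' f', e = r → e' ≠ r → EdgeRel σ τ e f → EdgeRel σ τ e' f' →
        Qr pw pb e f e' f' := by
      intro e f e' f' he he' hR hR'
      subst he
      rcases hR with rfl | rfl | rfl
      · exact C.q3 he' hR'
      · exact C.q1 he'
      · exact C.q2 he'
    by_cases he : e = r <;> by_cases he' : e' = r
    · subst he
      subst he'
      have s := C.hσ e'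
      have t := C.hτ e'
      rcases hR with rfl | rfl | rfl <;> rcases hR' with rfl | rfl | rfl
      · exact absurd hne (by simp)
      · exact C.q4 s
      · exact C.q4 t
      · exact (C.q4 s).symm
      · exact absurd hne (by simp)
      · exact C.q5
      · exact (C.q4 t).symm
      · exact C.q5.symm
      · exact absurd hne (by simp)
    · exact key _ _ _ _ he he' hR hR'
    · exact (key _ _ _ _ he' he hR' hR).symm
    · rcases hR with rfl | rfl | rfl <;> rcases hR' with rfl | rfl | rfl
      · exact C.qDD he he' (by tauto)
      · exact C.qDV he he'
      · exact C.qDH he he'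
      · exact (C.qDV he' he).symm
      · refine C.qVV he he' (fun h => ?_)
        subst h; simp at hne
      · exact C.qVH he he'
      · exact (C.qDH he' he).symm
      · exact (C.qVH he' he).symm
      · refine C.qHH he he' (fun h => ?_)
        subst h; simp at hne

end Cfg
end geomtwo

section growth
variable {E : Type} [Fintype E]

structure HI (σ τ : Perm E) (r : E) (A B : Finset E) (x y : E → ℕ) : Prop where
  cl : ∀ e f, Perm.SameCycle σ e f → e ∈ A → f ∈ A
  rA : r ∈ A
  inj : ∀ e ∈ A, ∀ f ∈ A, x e = x f → e = f
  lt : ∀ e ∈ A, x e < A.card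
  xr : x r = 0
  I4 : ∀ s ∈ A, s ≠ r → x s = x (σ⁻¹ s) + 1 ∨ (x s < x (σ⁻¹ s) ∧ s ∈ B ∧ y s = y (τ⁻¹ s) + 1 ∧
    (∀ e ∈ A, x s ≤ x e → x e ≤ x (σ⁻¹ s) → Perm.SameCycle σ s e) ∧
    ∀ e ∈ B, Perm.SameCycle σ s e → y s ≤ y e)
  I6 : ∀ e ∈ A, ¬ Perm.SameCycle σ r e → x (σ⁻¹ r) < x e

def cyc (σ : Perm E) (s : E) : Finset E := Finset.univ.filter (fun f => Perm.SameCycle σ s f)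

lemma sc_inv' {σ : Perm E} {s f : E} (h : Perm.SameCycle σ s f) : Perm.SameCycle σ s (σ⁻¹ f) := by
  simpa using h

lemma mem_cyc {σ : Perm E} {s f : E} : f ∈ cyc σ s ↔ Perm.SameCycle σ s f := by simp [cyc]

lemma idx (σ : Perm E) (s : E) (hs : σ s ≠ s) : ∃ i : E → ℕ, i s = 0 ∧
    (∀ f ∈ cyc σ s, f ≠ s → i f = i (σ⁻¹ f) + 1) ∧ (∀ f ∈ cyc σ s, i f < (cyc σ s).card) ∧
    (∀ f ∈ cyc σ s, ∀ g ∈ cyc σ s, i f = i g → f = g) := by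
  let i : E → ℕ := fun f => sInf {k | (σ ^ k) s = f}
  have ex : ∀ f ∈ cyc σ s, ∃ k, k < (cyc σ s).card ∧ (σ ^ k) s = f := by
    intro f hf
    obtain ⟨k, hk, h⟩ := (mem_cyc.1 hf).exists_pow_eq_of_mem_support (Perm.mem_support.2 hs)
    refine ⟨k, ?_, h⟩
    have : (σ.cycleOf s).support = cyc σ s := by
      ext g
      rw [mem_cyc, Perm.mem_support_cycleOf_iff' hs]
    rwa [this] at hk
  have mem : ∀ f ∈ cyc σ s, (σ ^ (i f)) s = f := by
    intro f hf
    obtain ⟨k, -, h⟩ := ex f hf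
    exact Nat.sInf_mem (s := {k | (σ ^ k) s = f}) ⟨k, h⟩
  have le : ∀ f k, (σ ^ k) s = f → i f ≤ k := fun f k h =>
    Nat.sInf_le (s := {k | (σ ^ k) s = f}) h
  refine ⟨i, ?_, ?_, ?_, ?_⟩
  · have := le s 0 (by simp); omega
  · intro f hf hne
    have h1 := mem f hf
    have h2 := mem (σ⁻¹ f) (mem_cyc.2 (sc_inv' (mem_cyc.1 hf)))
    have h3 : i f ≤ i (σ⁻¹ f) + 1 := by
      apply le
      rw [pow_succ', Perm.mul_apply, h2]; simp
    obtain ⟨k, hk⟩ : ∃ k, i f = k + 1 := by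
      cases h : i f with
      | zero => rw [h] at h1; exact absurd h1.symm (by simpa using hne)
      | succ k => exact ⟨k, rfl⟩
    have h4 : i (σ⁻¹ f) ≤ k := by
      apply le
      rw [hk, pow_succ', Perm.mul_apply] at h1
      rw [← h1]; simp
    omega
  · intro f hf
    obtain ⟨k, hk, h⟩ := ex f hf
    exact lt_of_le_of_lt (le f k h) hk
  · intro f hf g hg h
    rw [← mem f hf, h, mem g hg]

lemma step {σ τ : Perm E} {r : E} {A B : Finset E} {x y : E → ℕ} (hσ : ∀ e, σ e ≠ e)
    (h1 : HI σ τ r A B x y) (h2 : HI τ σ r B A y x) {e : E} (eB : e ∈ B) (eA : e ∉ A) :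
    ∃ x', HI σ τ r (A ∪ cyc σ e) B x' y ∧ HI τ σ r B (A ∪ cyc σ e) y x' := by
  obtain ⟨s, hs, hmin⟩ := Finset.exists_min_image (cyc σ e ∩ B) y
    ⟨e, Finset.mem_inter.2 ⟨mem_cyc.2 (Perm.SameCycle.refl _ _), eB⟩⟩
  rw [Finset.mem_inter, mem_cyc] at hs
  obtain ⟨hs, sB⟩ := hs
  have hX : cyc σ e = cyc σ s := by
    ext f; rw [mem_cyc, mem_cyc]; exact ⟨fun h => hs.symm.trans h, fun h => hs.trans h⟩
  rw [hX] at hmin ⊢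
  have sX : s ∈ cyc σ s := mem_cyc.2 (Perm.SameCycle.refl _ _)
  have dis : ∀ f ∈ cyc σ s, f ∉ A := by
    intro f hf hfA
    exact eA (h1.cl f e ((hs.trans (mem_cyc.1 hf)).symm) hfA)
  obtain ⟨i, i0, i1, i2, i3⟩ := idx σ s (hσ s)
  have cardU : (A ∪ cyc σ s).card = A.card + (cyc σ s).card :=
    Finset.card_union_of_disjoint (Finset.disjoint_left.2 fun f hA hX => dis f hX hA)
  let x' : E → ℕ := fun f => if f ∈ A then x f else A.card + i f
  have xA : ∀ f ∈ A, x' f = x f := fun f hf => by simp [x', hf]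
  have xX : ∀ f ∈ cyc σ s, x' f = A.card + i f := fun f hf => by simp [x', dis f hf]
  have xlt : ∀ f ∈ A, x' f < A.card := fun f hf => by rw [xA f hf]; exact h1.lt f hf
  have xge : ∀ f ∈ cyc σ s, A.card ≤ x' f := fun f hf => by rw [xX f hf]; omega
  have Ainv : ∀ f ∈ A, σ⁻¹ f ∈ A := fun f hf => h1.cl _ _ (sc_inv' (Perm.SameCycle.refl _ _)) hf
  have Xinv : ∀ f ∈ cyc σ s, σ⁻¹ f ∈ cyc σ s := fun f hf => mem_cyc.2 (sc_inv' (mem_cyc.1 hf))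
  have mU : ∀ f, f ∈ A ∪ cyc σ s ↔ f ∈ A ∨ f ∈ cyc σ s := fun f => Finset.mem_union
  refine ⟨x', ⟨?_, ?_, ?_, ?_, ?_, ?_, ?_⟩, ⟨h2.cl, h2.rA, h2.inj, h2.lt, h2.xr, ?_, h2.I6⟩⟩
  · intro f g hfg hf
    rw [mU] at hf ⊢
    rcases hf with hf | hf
    · left; exact h1.cl f g hfg hf
    · right; exact mem_cyc.2 ((mem_cyc.1 hf).trans hfg)
  · rw [mU]; left; exact h1.rA
  · intro f hf g hg hfg
    rw [mU] at hf hg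
    rcases hf with hf | hf <;> rcases hg with hg | hg
    · exact h1.inj f hf g hg (by rw [← xA f hf, hfg, xA g hg])
    · have := xlt f hf; have := xge g hg; omega
    · have := xlt g hg; have := xge f hf; omega
    · apply i3 f hf g hg; rw [xX f hf, xX g hg] at hfg; omega
  · intro f hf
    rw [mU] at hf
    rw [cardU]
    rcases hf with hf | hf
    · have := xlt f hf; omega
    · have := i2 f hf; rw [xX f hf]; omega
  · rw [xA r h1.rA, h1.xr]
  · intro f hf hfr
    rw [mU] at hf
    rcases hf with hf | hf
    · rw [xA f hf, xA _ (Ainv f hf)]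
      rcases h1.I4 f hf hfr with h | ⟨a, b, c, d, k⟩
      · left; exact h
      · right
        refine ⟨a, b, c, ?_, k⟩
        intro g hg hg1 hg2
        rw [mU] at hg
        rcases hg with hg | hg
        · rw [xA g hg] at hg1 hg2
          exact d g hg hg1 hg2
        · have := xge g hg
          have := h1.lt _ (Ainv f hf)
          omega
    · by_cases hfs : f = s
      · right
        subst hfs
        refine ⟨?_, sB, ?_, ?_, ?_⟩
        · rw [xX f hf, xX _ (Xinv f hf), i0]
          have : i (σ⁻¹ f) ≠ i f := by
            intro h
            have h3 := i3 _ (Xinv f hf) _ hf h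
            apply hσ f
            conv_lhs => rw [← h3]
            simp
          omega
        · rcases h2.I4 f sB hfr with h | h
          · exact h
          · exact absurd h.2.1 (dis f hf)
        · intro g hg hg1 _
          rw [mU] at hg
          rcases hg with hg | hg
          · have := xge f hf; have := xlt g hg; omega
          · exact mem_cyc.1 hg
        · intro g hg hfg
          exact hmin g (Finset.mem_inter.2 ⟨mem_cyc.2 hfg, hg⟩)
      · left
        rw [xX f hf, xX _ (Xinv f hf), i1 f hf hfs]; omega
  · intro f hf hfr
    rw [mU] at hf
    rw [xA _ (Ainv r h1.rA)]
    rcases hf with hf | hf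
    · rw [xA f hf]; exact h1.I6 f hf hfr
    · have := xge f hf
      have := h1.lt _ (Ainv r h1.rA)
      omega
  · intro f hf hfr
    rcases h2.I4 f hf hfr with h | ⟨a, b, c, d, k⟩
    · left; exact h
    · right
      refine ⟨a, ?_, ?_, d, ?_⟩
      · rw [mU]; left; exact b
      · rw [xA f b, xA _ (Ainv f b)]; exact c
      · intro g hg hfg
        rw [mU] at hg
        rcases hg with hg | hg
        · rw [xA f b, xA g hg]; exact k g hg hfg
        · have := xlt f b; have := xge g hg; omega

lemma init_hi {σ : Perm E} (hσ : ∀ e, σ e ≠ e) (r : E) :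
    ∃ x, ∀ τ B y, HI σ τ r (cyc σ r) B x y := by
  obtain ⟨i, i0, i1, i2, i3⟩ := idx σ r (hσ r)
  refine ⟨i, fun τ B y => ⟨?_, mem_cyc.2 (Perm.SameCycle.refl _ _), i3, i2, i0, ?_, ?_⟩⟩
  · intro e f h he
    exact mem_cyc.2 ((mem_cyc.1 he).trans h)
  · intro s hs hsr
    left; exact i1 s hs hsr
  · intro e he h
    exact absurd (mem_cyc.1 he) h

lemma grow_aux {σ τ : Perm E} (hσ : ∀ e, σ e ≠ e) (hτ : ∀ e, τ e ≠ e) {r : E} (T : Set E)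
    (Tσ : ∀ e f, Perm.SameCycle σ e f → e ∈ T → f ∈ T)
    (Tτ : ∀ e f, Perm.SameCycle τ e f → e ∈ T → f ∈ T) (n : ℕ) :
    ∀ (A B : Finset E) (x y : E → ℕ), HI σ τ r A B x y → HI τ σ r B A y x → (∀ e ∈ A, e ∈ T) →
      (∀ e ∈ B, e ∈ T) → 2 * Fintype.card E < A.card + B.card + n →
    ∃ (S : Finset E) (x y : E → ℕ), HI σ τ r S S x y ∧ HI τ σ r S S y x ∧ ∀ e ∈ S, e ∈ T := by
  induction n with
  | zero =>
    intro A B x y _ _ _ _ h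
    have := A.card_le_univ
    have := B.card_le_univ
    omega
  | succ n ih =>
    intro A B x y h1 h2 hA hB hn
    by_cases hBA : ∃ e ∈ B, e ∉ A
    · obtain ⟨e, eB, eA⟩ := hBA
      obtain ⟨x', g1, g2⟩ := step hσ h1 h2 eB eA
      refine ih _ _ _ _ g1 g2 ?_ hB ?_
      · intro f hf
        rcases Finset.mem_union.1 hf with hf | hf
        · exact hA f hf
        · exact Tσ e f (mem_cyc.1 hf) (hB e eB)
      · have : A.card < (A ∪ cyc σ e).card := by
          apply Finset.card_lt_card
          refine ⟨Finset.subset_union_left, fun h => eA (h ?_)⟩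
          exact Finset.mem_union_right _ (mem_cyc.2 (Perm.SameCycle.refl _ _))
        omega
    · by_cases hAB : ∃ e ∈ A, e ∉ B
      · obtain ⟨e, eB, eA⟩ := hAB
        obtain ⟨x', g1, g2⟩ := step hτ h2 h1 eB eA
        refine ih _ _ _ _ g2 g1 hA ?_ ?_
        · intro f hf
          rcases Finset.mem_union.1 hf with hf | hf
          · exact hB f hf
          · exact Tτ e f (mem_cyc.1 hf) (hA e eB)
        · have : B.card < (B ∪ cyc τ e).card := by
            apply Finset.card_lt_card
            refine ⟨Finset.subset_union_left, fun h => eA (h ?_)⟩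
            exact Finset.mem_union_right _ (mem_cyc.2 (Perm.SameCycle.refl _ _))
          omega
      · push Not at hBA hAB
        have : A = B := Finset.Subset.antisymm hAB hBA
        subst this
        exact ⟨A, x, y, h1, h2, hA⟩

lemma grow {σ τ : Perm E} (hσ : ∀ e, σ e ≠ e) (hτ : ∀ e, τ e ≠ e) {r : E} (T : Set E)
    (Tσ : ∀ e f, Perm.SameCycle σ e f → e ∈ T → f ∈ T)
    (Tτ : ∀ e f, Perm.SameCycle τ e f → e ∈ T → f ∈ T) (hr : r ∈ T) :
    ∃ (S : Finset E) (x y : E → ℕ), HI σ τ r S S x y ∧ HI τ σ r S S y x ∧ ∀ e ∈ S, e ∈ T := by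
  obtain ⟨x, hx⟩ := init_hi hσ r
  obtain ⟨y, hy⟩ := init_hi hτ r
  exact grow_aux hσ hτ T Tσ Tτ (2 * Fintype.card E + 1) _ _ x y (hx _ _ _) (hy _ _ _)
    (fun e he => Tσ r e (mem_cyc.1 he) hr) (fun e he => Tτ r e (mem_cyc.1 he) hr) (by omega)

end growth

section comp

def Grid (M : ℕ) (p : Pt) : Prop := ∃ a b : ℕ, a < M ∧ b < M ∧ p = ((a : ℝ), (b : ℝ))

lemma seg_trans {a b v p : Pt} (h : p ∈ segment ℝ (a + v) (b + v)) : p - v ∈ segment ℝ a b := by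
  rw [add_comm a, add_comm b, ← mem_segment_translate ℝ (-v)] at h
  simpa [sub_eq_neg_add] using h

lemma Gd.trans {E : Type} {R : E → E → Prop} {pw pb : E → Pt} (h : Gd R pw pb) (v : Pt) :
    Gd R (fun e => pw e + v) (fun e => pb e + v) where
  injw := fun e f hh => h.injw (add_right_cancel hh)
  injb := fun e f hh => h.injb (add_right_cancel hh)
  wb := fun e f hh => h.wb e f (add_right_cancel hh)
  nw := fun e => by simpa using h.nw e
  nb := fun e => by simpa using h.nb e
  q := by
    intro e f e' f' hR hR' hne p hp hp'
    rcases h.q e f e' f' hR hR' hne (p - v) (seg_trans hp) (seg_trans hp') with ⟨a, b⟩ | ⟨a, b⟩ | a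
    · left; exact ⟨a, by simp only; rw [← b]; simp⟩
    · right; left; exact ⟨a, by simp only; rw [← b]; simp⟩
    · right; right; simpa [SegOrth] using a

variable {E : Type} [Fintype E]

lemma half_of {σ τ : Perm E} {r : E} {S : Finset E} {x y : E → ℕ}
    (h : HI σ τ r S S x y) (hσ : ∀ e, σ e ∈ S ↔ e ∈ S) (hτ : ∀ e, τ e ∈ S ↔ e ∈ S)
    {X Y : {e // e ∈ S} → ℝ} (hX : ∀ e f, X e < X f ↔ x e.1 < x f.1)
    (hY : ∀ e f, Y e < Y f ↔ y e.1 < y f.1) :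
    Half (σ.subtypePerm hσ) (τ.subtypePerm hτ) ⟨r, h.rA⟩ X Y := by
  have hX' : ∀ e f, X e ≤ X f ↔ x e.1 ≤ x f.1 := fun e f => by
    rw [← not_lt, hX, not_lt]
  have hY' : ∀ e f, Y e ≤ Y f ↔ y e.1 ≤ y f.1 := fun e f => by
    rw [← not_lt, hY, not_lt]
  intro s hs
  have hs' : s.1 ≠ r := fun h => hs (Subtype.ext h)
  have e1 : (((σ.subtypePerm hσ)⁻¹ s : {e // e ∈ S}) : E) = σ⁻¹ s.1 := by simp
  have e2 : (((τ.subtypePerm hτ)⁻¹ s : {e // e ∈ S}) : E) = τ⁻¹ s.1 := by simp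
  simp only [hX, hY, hX', hY', e1, e2]
  rcases h.I4 s.1 s.2 hs' with a | ⟨a, b, c, d, k⟩
  · left
    exact ⟨by omega, fun e he => by omega⟩
  · right
    refine ⟨a, by omega, fun e he => by omega, fun e h1 h2 => ?_, fun e h1 => ?_⟩
    · exact Perm.sameCycle_subtypePerm.2 (d e.1 e.2 h1 h2)
    · exact k e.1 e.2 (Perm.sameCycle_subtypePerm.1 h1)

lemma comp_case {σ τ : Perm E} {r : E} {S : Finset E} {x y : E → ℕ}
    (h1 : HI σ τ r S S x y) (h2 : HI τ σ r S S y x)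
    (s1 : ∀ e, σ e ≠ e) (s2 : ∀ e, τ e ≠ e) (s3 : ∀ e, σ e ≠ τ e)
    (hσ : ∀ e, σ e ∈ S ↔ e ∈ S) (hτ : ∀ e, τ e ∈ S ↔ e ∈ S)
    (hm : x (σ⁻¹ r) < x (τ⁻¹ r) ∨ ∀ e ∈ S, y e ≤ y (τ⁻¹ r)) :
    ∃ pw pb : {e // e ∈ S} → Pt, Gd (EdgeRel (σ.subtypePerm hσ) (τ.subtypePerm hτ)) pw pb ∧
      (∀ e, Grid (4 * S.card) (pw e)) ∧ ∀ e, Grid (4 * S.card) (pb e) := by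
  let R : {e // e ∈ S} := ⟨r, h1.rA⟩
  let X : {e // e ∈ S} → ℝ := fun e => (x e.1 : ℝ)
  let Y : {e // e ∈ S} → ℝ := fun e => if e = R then -2 * (S.card : ℝ) else (y e.1 : ℝ)
  have N1 : 1 ≤ S.card := Finset.card_pos.2 ⟨r, h1.rA⟩
  have N1' : (1 : ℝ) ≤ S.card := by exact_mod_cast N1
  have ypos : ∀ e : {e // e ∈ S}, e ≠ R → 0 < y e.1 := by
    intro e he
    rcases Nat.eq_zero_or_pos (y e.1) with h | h
    · exact absurd (Subtype.ext (h2.inj e.1 e.2 r h2.rA (by rw [h, h2.xr]))) he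
    · exact h
  have YR : Y R = -2 * (S.card : ℝ) := by simp [Y]
  have Yne : ∀ e, e ≠ R → Y e = y e.1 := fun e he => by simp [Y, he]
  have hX : ∀ e f, X e < X f ↔ x e.1 < x f.1 := fun e f => by simp [X]
  have hY : ∀ e f, Y e < Y f ↔ y e.1 < y f.1 := by
    intro e f
    by_cases he : e = R <;> by_cases hf : f = R
    · rw [he, hf]; simp
    · have := ypos f hf
      have h0 : y e.1 = 0 := by rw [he]; exact h2.xr
      rw [he, YR, ← he, Yne f hf, h0]
      refine ⟨fun _ => this, fun _ => ?_⟩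
      have : (0 : ℝ) ≤ y f.1 := by positivity
      linarith
    · have h0 : y f.1 = 0 := by rw [hf]; exact h2.xr
      rw [hf, YR, ← hf, Yne e he, h0]
      refine ⟨fun h => ?_, fun h => by omega⟩
      have : (0 : ℝ) ≤ y e.1 := by positivity
      linarith
    · rw [Yne e he, Yne f hf]; simp
  have P1 := half_of h1 hσ hτ hX hY
  have P2 := half_of h2 hτ hσ hY hX
  have xlt : ∀ e : {e // e ∈ S}, (x e.1 : ℝ) ≤ S.card - 1 := fun e => by
    have := h1.lt e.1 e.2
    have : ((x e.1 + 1 : ℕ) : ℝ) ≤ S.card := by exact_mod_cast this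
    push_cast at this; linarith
  have ylt : ∀ e : {e // e ∈ S}, (y e.1 : ℝ) ≤ S.card - 1 := fun e => by
    have := h2.lt e.1 e.2
    have : ((y e.1 + 1 : ℕ) : ℝ) ≤ S.card := by exact_mod_cast this
    push_cast at this; linarith
  have tR : (τ.subtypePerm hτ)⁻¹ R ≠ R := by
    intro h
    have h' := congrArg (τ.subtypePerm hτ) h
    have h'' := congrArg Subtype.val h'
    simp at h''
    exact s2 r h''.symm
  have e1 : (((σ.subtypePerm hσ)⁻¹ R : {e // e ∈ S}) : E) = σ⁻¹ r := by simp [R]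
  have e2 : (((τ.subtypePerm hτ)⁻¹ R : {e // e ∈ S}) : E) = τ⁻¹ r := by simp [R]
  obtain ⟨m, hm1, hm2⟩ : ∃ m : ℕ, m ≤ S.card ∧
      (((m : ℝ) = Y ((τ.subtypePerm hτ)⁻¹ R) ∧
          X ((σ.subtypePerm hσ)⁻¹ R) < X ((τ.subtypePerm hτ)⁻¹ R)) ∨
        ((m : ℝ) = Y ((τ.subtypePerm hτ)⁻¹ R) + 1 ∧ ∀ e, Y e ≤ Y ((τ.subtypePerm hτ)⁻¹ R))) := by
    have hlt := h2.lt _ ((τ.subtypePerm hτ)⁻¹ R).2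
    rw [e2] at hlt
    rcases hm with hm | hm
    · refine ⟨y (τ⁻¹ r), by omega, Or.inl ⟨?_, ?_⟩⟩
      · rw [Yne _ tR, e2]
      · rw [hX, e1, e2]; exact hm
    · refine ⟨y (τ⁻¹ r) + 1, by omega, Or.inr ⟨?_, fun e => ?_⟩⟩
      · rw [Yne _ tR, e2]; push_cast; rfl
      · rw [← not_lt, hY, not_lt, e2]; exact hm e.1 e.2
  have C : Cfg (σ.subtypePerm hσ) (τ.subtypePerm hτ) R X Y (S.card : ℝ) (m : ℝ) := {
    hx := fun e f h => Subtype.ext (h1.inj e.1 e.2 f.1 f.2 (by simpa [X] using h))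
    hy := fun e f h => by
      have a := hY e f
      have b := hY f e
      rw [h] at a b
      simp only [lt_self_iff_false, false_iff, not_lt] at a b
      exact Subtype.ext (h2.inj e.1 e.2 f.1 f.2 (le_antisymm b a))
    P1 := P1
    P2 := P2
    hσ := fun e h => s1 e.1 (congrArg Subtype.val h)
    hτ := fun e h => s2 e.1 (congrArg Subtype.val h)
    hστ := fun e h => s3 e.1 (congrArg Subtype.val h)
    xr := by simp [X, R, h1.xr]
    x0 := fun e => by simp [X]
    xN := xlt
    yr := YR
    y0 := fun e he => by rw [Yne e he]; positivity
    yN := fun e => by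
      by_cases he : e = R
      · rw [he, YR]; linarith
      · rw [Yne e he]; exact ylt e
    hN := N1'
    hm := hm2 }
  have G := C.gd.trans (2 * (S.card : ℝ), 2 * (S.card : ℝ))
  refine ⟨_, _, G, fun e => ?_, fun e => ?_⟩
  · by_cases he : e = R
    · refine ⟨0, m + 2 * S.card, by omega, by omega, ?_⟩
      rw [he, PW_r]; ext <;> simp
    · have a1 := h1.lt e.1 e.2
      have a2 := h2.lt e.1 e.2
      refine ⟨x e.1 + 2 * S.card, y e.1 + 2 * S.card, by omega, by omega, ?_⟩
      rw [PW_ne he, Yne e he]; ext <;> simp [X]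
  · have a1 := h1.lt _ ((σ.subtypePerm hσ)⁻¹ e).2
    have a2 := h2.lt _ ((τ.subtypePerm hτ)⁻¹ e).2
    by_cases he : e = R
    · refine ⟨x ((σ.subtypePerm hσ)⁻¹ e).1 + 2 * S.card, m + 2 * S.card, by omega, by omega, ?_⟩
      rw [he, PB_r]; ext <;> simp [X]
    · by_cases ht : (τ.subtypePerm hτ)⁻¹ e = R
      · refine ⟨x ((σ.subtypePerm hσ)⁻¹ e).1 + 2 * S.card, 0, by omega, by omega, ?_⟩
        rw [PB_ne he, ht, YR]; ext <;> simp [X]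
      · refine ⟨x ((σ.subtypePerm hσ)⁻¹ e).1 + 2 * S.card,
          y ((τ.subtypePerm hτ)⁻¹ e).1 + 2 * S.card, by omega, by omega, ?_⟩
        rw [PB_ne he, Yne _ ht]; ext <;> simp [X]

lemma HI.iff {σ τ : Perm E} {r : E} {A B : Finset E} {x y : E → ℕ} (h : HI σ τ r A B x y) (e : E) :
    σ e ∈ A ↔ e ∈ A :=
  ⟨h.cl _ _ (by simp [Perm.SameCycle.refl]), h.cl _ _ (by simp [Perm.SameCycle.refl])⟩

lemma sc_of_all {σ τ : Perm E} (h : ∀ r, Perm.SameCycle σ r (τ⁻¹ r)) {e f : E}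
    (hef : Perm.SameCycle τ e f) : Perm.SameCycle σ e f := by
  obtain ⟨i, -, -, hi⟩ := (Perm.sameCycle_inv.2 hef).exists_pow_eq
  subst hi
  induction i with
  | zero => exact Perm.SameCycle.refl _ _
  | succ i ih =>
    rw [pow_succ', Perm.mul_apply]
    refine Perm.SameCycle.trans (ih ?_) (h _)
    rw [← Perm.sameCycle_inv]
    exact ⟨i, by simp⟩

lemma comp_exists [Nonempty E] {σ τ : Perm E} 
    (s1 : ∀ e, σ e ≠ e) (s2 : ∀ e, τ e ≠ e) (s3 : ∀ e, σ e ≠ τ e) :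
    ∃ S : Finset E, S.Nonempty ∧ ∃ (hσ : ∀ e, σ e ∈ S ↔ e ∈ S) (hτ : ∀ e, τ e ∈ S ↔ e ∈ S),
    ∃ pw pb : {e // e ∈ S} → Pt, Gd (EdgeRel (σ.subtypePerm hσ) (τ.subtypePerm hτ)) pw pb ∧
      (∀ e, Grid (4 * S.card) (pw e)) ∧ ∀ e, Grid (4 * S.card) (pb e) := by
  by_cases hB : ∃ r, ¬ Perm.SameCycle σ r (τ⁻¹ r)
  · obtain ⟨r, hr⟩ := hB
    obtain ⟨S, x, y, h1, h2, -⟩ := grow s1 s2 (r := r) Set.univ (by simp) (by simp) (by simp)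
    refine ⟨S, ⟨r, h1.rA⟩, h1.iff, h2.iff, comp_case h1 h2 s1 s2 s3 _ _ (Or.inl ?_)⟩
    exact h1.I6 _ (h2.cl _ _ (sc_inv' (Perm.SameCycle.refl _ _)) h1.rA) hr
  · push Not at hB
    obtain ⟨r⟩ := ‹Nonempty E›
    obtain ⟨S, x, y, h1, h2, hT⟩ := grow s2 s1 (r := r) {e | Perm.SameCycle σ r e}
      (fun e f h he => Perm.SameCycle.trans he (sc_of_all hB h))
      (fun e f h he => Perm.SameCycle.trans he h) (Perm.SameCycle.refl _ _)
    have cons : ∀ s ∈ S, s ≠ r → y s = y (σ⁻¹ s) + 1 := by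
      intro s hs hsr
      rcases h2.I4 s hs hsr with h | ⟨a, b, c, d, k⟩
      · exact h
      · exfalso
        have := k r h1.rA (Perm.SameCycle.symm (hT s hs))
        rw [h1.xr] at this
        exact hsr (h1.inj s hs r h1.rA (by rw [h1.xr]; omega))
    obtain ⟨pw, pb, hG, g1, g2⟩ := comp_case h1 h2 s2 s1 (fun e => (s3 e).symm) h1.iff h2.iff (by
      right
      obtain ⟨e, he, hmax⟩ := Finset.exists_max_image S y ⟨r, h1.rA⟩
      have hse : σ e ∈ S := (h2.iff e).2 he
      by_cases h : σ e = r
      · have : σ⁻¹ r = e := by rw [← h]; simp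
        rw [this]; exact hmax
      · have h3 := cons _ hse h
        have h4 := hmax _ hse
        rw [perm_inv_self] at h3
        omega)
    refine ⟨S, ⟨r, h1.rA⟩, h2.iff, h1.iff, pw, pb, ?_, g1, g2⟩
    have : ∀ a b : Perm {e // e ∈ S}, EdgeRel a b = EdgeRel b a := by
      intro a b; funext e f; unfold EdgeRel; apply propext; tauto
    rw [this]; exact hG

end comp

section combine

lemma seg_fst_lt {a b p : Pt} {K : ℝ} (h : p ∈ segment ℝ a b) (ha : a.1 < K) (hb : b.1 < K) :
    p.1 < K := by
  have := seg_cases h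
  unfold Btwn at this
  rcases this with h | h | ⟨h | h | h, -⟩ <;> linarith [h.1, h.2]

lemma seg_fst_ge {a b p : Pt} {K : ℝ} (h : p ∈ segment ℝ a b) (ha : K ≤ a.1) (hb : K ≤ b.1) :
    K ≤ p.1 := by
  have := seg_cases h
  unfold Btwn at this
  rcases this with h | h | ⟨h | h | h, -⟩ <;> linarith [h.1, h.2]

lemma glue {E : Type} {R : E → E → Prop} {P : E → Prop} (hR : ∀ e f, R e f → (P e ↔ P f))
    {a b : {e // P e} → Pt} {c d : {e // ¬ P e} → Pt}
    (h1 : Gd (fun e f : {e // P e} => R e.1 f.1) a b)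
    (h2 : Gd (fun e f : {e // ¬ P e} => R e.1 f.1) c d) {K : ℝ}
    (ha : ∀ e, (a e).1 < K) (hb : ∀ e, (b e).1 < K) (hc : ∀ e, K ≤ (c e).1)
    (hd : ∀ e, K ≤ (d e).1) :
    Gd R (fun e => if h : P e then a ⟨e, h⟩ else c ⟨e, h⟩)
      (fun e => if h : P e then b ⟨e, h⟩ else d ⟨e, h⟩) where
  injw := by
    intro e f h
    by_cases he : P e <;> by_cases hf : P f <;> simp only [he, hf, dite_true, dite_false] at h
    · exact congrArg Subtype.val (h1.injw h)
    · have := ha ⟨e, he⟩; have := hc ⟨f, hf⟩; rw [h] at *; linarith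
    · have := ha ⟨f, hf⟩; have := hc ⟨e, he⟩; rw [h] at *; linarith
    · exact congrArg Subtype.val (h2.injw h)
  injb := by
    intro e f h
    by_cases he : P e <;> by_cases hf : P f <;> simp only [he, hf, dite_true, dite_false] at h
    · exact congrArg Subtype.val (h1.injb h)
    · have := hb ⟨e, he⟩; have := hd ⟨f, hf⟩; rw [h] at *; linarith
    · have := hb ⟨f, hf⟩; have := hd ⟨e, he⟩; rw [h] at *; linarith
    · exact congrArg Subtype.val (h2.injb h)
  wb := by
    intro e f h
    by_cases he : P e <;> by_cases hf : P f <;> simp only [he, hf, dite_true, dite_false] at h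
    · exact h1.wb _ _ h
    · have := ha ⟨e, he⟩; have := hd ⟨f, hf⟩; rw [h] at *; linarith
    · have := hb ⟨f, hf⟩; have := hc ⟨e, he⟩; rw [h] at *; linarith
    · exact h2.wb _ _ h
  nw := by
    intro e
    by_cases he : P e
    · obtain ⟨f, f', r1, r2, h⟩ := h1.nw ⟨e, he⟩
      refine ⟨f.1, f'.1, r1, r2, ?_⟩
      simpa only [he, f.2, f'.2, dite_true] using h
    · obtain ⟨f, f', r1, r2, h⟩ := h2.nw ⟨e, he⟩
      refine ⟨f.1, f'.1, r1, r2, ?_⟩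
      simpa only [he, f.2, f'.2, dite_false] using h
  nb := by
    intro e
    by_cases he : P e
    · obtain ⟨f, f', r1, r2, h⟩ := h1.nb ⟨e, he⟩
      refine ⟨f.1, f'.1, r1, r2, ?_⟩
      simpa only [he, f.2, f'.2, dite_true] using h
    · obtain ⟨f, f', r1, r2, h⟩ := h2.nb ⟨e, he⟩
      refine ⟨f.1, f'.1, r1, r2, ?_⟩
      simpa only [he, f.2, f'.2, dite_false] using h
  q := by
    intro e f e' f' r1 r2 hne p hp hp'
    have i1 := hR _ _ r1
    have i2 := hR _ _ r2
    by_cases he : P e <;> by_cases he' : P e'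
    · have hf := i1.1 he
      have hf' := i2.1 he'
      simp only [he, he', hf, hf', dite_true] at hp hp' ⊢
      rcases h1.q ⟨e, he⟩ ⟨f, hf⟩ ⟨e', he'⟩ ⟨f', hf'⟩ r1 r2 (by simpa using hne) p hp hp' with
        ⟨k1, k2⟩ | ⟨k1, k2⟩ | k
      · left; exact ⟨congrArg Subtype.val k1, k2⟩
      · right; left; exact ⟨congrArg Subtype.val k1, k2⟩
      · right; right; exact k
    · exfalso
      have hf := i1.1 he
      have hf' : ¬ P f' := fun h => he' (i2.2 h)
      simp only [he, he', hf, hf', dite_true, dite_false] at hp hp'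
      have := seg_fst_lt hp (ha _) (hb _)
      have := seg_fst_ge hp' (hc _) (hd _)
      linarith
    · exfalso
      have hf : ¬ P f := fun h => he (i1.2 h)
      have hf' := i2.1 he'
      simp only [he, he', hf, hf', dite_true, dite_false] at hp hp'
      have := seg_fst_ge hp (hc _) (hd _)
      have := seg_fst_lt hp' (ha _) (hb _)
      linarith
    · have hf : ¬ P f := fun h => he (i1.2 h)
      have hf' : ¬ P f' := fun h => he' (i2.2 h)
      simp only [he, he', hf, hf', dite_false] at hp hp' ⊢
      rcases h2.q ⟨e, he⟩ ⟨f, hf⟩ ⟨e', he'⟩ ⟨f', hf'⟩ r1 r2 (by simpa using hne) p hp hp' with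
        ⟨k1, k2⟩ | ⟨k1, k2⟩ | k
      · left; exact ⟨congrArg Subtype.val k1, k2⟩
      · right; left; exact ⟨congrArg Subtype.val k1, k2⟩
      · right; right; exact k

lemma edgeRel_sub {E : Type} {σ τ : Perm E} {P : E → Prop} (hσ : ∀ e, P (σ e) ↔ P e)
    (hτ : ∀ e, P (τ e) ↔ P e) : EdgeRel (σ.subtypePerm hσ) (τ.subtypePerm hτ) =
      fun e f : {e // P e} => EdgeRel σ τ e.1 f.1 := by
  funext e f
  simp [EdgeRel, Subtype.ext_iff]

lemma draw_all (n : ℕ) : ∀ (E : Type) [Fintype E] (σ τ : Perm E), Fintype.card E = n →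
    (∀ e, σ e ≠ e) → (∀ e, τ e ≠ e) → (∀ e, σ e ≠ τ e) →
    ∃ pw pb : E → Pt, Gd (EdgeRel σ τ) pw pb ∧ (∀ e, Grid (4 * n) (pw e)) ∧
      ∀ e, Grid (4 * n) (pb e) := by
  induction n using Nat.strong_induction_on with
  | _ n ih =>
  intro E _ σ τ hn s1 s2 s3
  rcases isEmpty_or_nonempty E with hE | hE
  · exact ⟨fun e => (hE.false e).elim, fun e => (hE.false e).elim,
      ⟨fun e => (hE.false e).elim, fun e => (hE.false e).elim, fun e => (hE.false e).elim,
      fun e => (hE.false e).elim, fun e => (hE.false e).elim, fun e => (hE.false e).elim⟩,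
      fun e => (hE.false e).elim, fun e => (hE.false e).elim⟩
  obtain ⟨S, hS, hσ, hτ, a, b, hG, ga, gb⟩ := comp_exists s1 s2 s3
  have hσ' : ∀ e, ¬ σ e ∈ S ↔ ¬ e ∈ S := fun e => not_congr (hσ e)
  have hτ' : ∀ e, ¬ τ e ∈ S ↔ ¬ e ∈ S := fun e => not_congr (hτ e)
  have hcard : Fintype.card {e // ¬ e ∈ S} = n - S.card := by
    rw [Fintype.card_subtype_compl, hn, Fintype.card_coe]
  have hSn : S.card ≤ n := by rw [← hn]; exact S.card_le_univ
  have hS1 : 0 < S.card := hS.card_pos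
  obtain ⟨c, d, hG', gc, gd⟩ := ih (n - S.card) (by omega) {e // ¬ e ∈ S} (σ.subtypePerm hσ')
    (τ.subtypePerm hτ') hcard (fun e h => s1 e.1 (congrArg Subtype.val h))
    (fun e h => s2 e.1 (congrArg Subtype.val h)) (fun e h => s3 e.1 (congrArg Subtype.val h))
  rw [edgeRel_sub] at hG hG'
  have hG'' := hG'.trans (((4 * S.card : ℕ) : ℝ), ((4 * S.card : ℕ) : ℝ))
  have lt : ∀ p, Grid (4 * S.card) p → p.1 < ((4 * S.card : ℕ) : ℝ) := by
    rintro p ⟨i, j, hi, hj, rfl⟩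
    simp only; exact_mod_cast hi
  have ge : ∀ M p, Grid M p → ((4 * S.card : ℕ) : ℝ) ≤
      (p + (((4 * S.card : ℕ) : ℝ), ((4 * S.card : ℕ) : ℝ)) : Pt).1 := by
    rintro M p ⟨i, j, hi, hj, rfl⟩
    simp
  have g1 : ∀ p, Grid (4 * S.card) p → Grid (4 * n) p := by
    rintro p ⟨i, j, hi, hj, rfl⟩
    exact ⟨i, j, by omega, by omega, rfl⟩
  have g2 : ∀ p, Grid (4 * (n - S.card)) p →
      Grid (4 * n) (p + (((4 * S.card : ℕ) : ℝ), ((4 * S.card : ℕ) : ℝ)) : Pt) := by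
    rintro p ⟨i, j, hi, hj, rfl⟩
    exact ⟨i + 4 * S.card, j + 4 * S.card, by omega, by omega, by ext <;> simp⟩
  refine ⟨_, _, glue (P := fun e => e ∈ S) ?_ hG hG'' (fun e => lt _ (ga e)) (fun e => lt _ (gb e))
    (fun e => ge _ _ (gc e)) (fun e => ge _ _ (gd e)), ?_, ?_⟩
  · rintro e f (rfl | rfl | rfl)
    · rfl
    · exact (hσ e).symm
    · exact (hτ e).symm
  · intro e
    by_cases he : e ∈ S <;> simp only [he, dite_true, dite_false]
    · exact g1 _ (ga _)
    · exact g2 _ (gc _)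
  · intro e
    by_cases he : e ∈ S <;> simp only [he, dite_true, dite_false]
    · exact g1 _ (gb _)
    · exact g2 _ (gd _)

end combine

section transfer

lemma orth_two {d1 d2 a1 a2 b1 b2 : ℝ} (h1 : d1 * a1 + d2 * a2 = 0) (h2 : d1 * b1 + d2 * b2 = 0)
    (h : a1 * b2 ≠ a2 * b1) : d1 = 0 ∧ d2 = 0 := by
  have h' : a1 * b2 - a2 * b1 ≠ 0 := sub_ne_zero.2 h
  constructor
  · have : d1 * (a1 * b2 - a2 * b1) = 0 := by linear_combination b2 * h1 - a2 * h2
    exact (mul_eq_zero.1 this).resolve_right h'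
  · have : d2 * (a1 * b2 - a2 * b1) = 0 := by linear_combination a1 * h2 - b1 * h1
    exact (mul_eq_zero.1 this).resolve_right h'

lemma orth_shared {a b c p : Pt} (h : SegOrth a b a c) (hne : a ≠ b) (hp : p ∈ segment ℝ a b)
    (hp' : p ∈ segment ℝ a c) : p = a := by
  obtain ⟨t, -, -, t1, t2⟩ := seg_param hp
  obtain ⟨s, -, -, s1, s2⟩ := seg_param hp'
  unfold SegOrth at h
  have e1 : t * (b.1 - a.1) = s * (c.1 - a.1) := by linarith
  have e2 : t * (b.2 - a.2) = s * (c.2 - a.2) := by linarith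
  have e3 : t * ((b.1 - a.1) ^ 2 + (b.2 - a.2) ^ 2) = 0 := by
    linear_combination (b.1 - a.1) * e1 + (b.2 - a.2) * e2 + s * h
  rcases mul_eq_zero.1 e3 with h0 | h0
  · rw [h0] at t1 t2
    exact Prod.ext (by linarith) (by linarith)
  · exfalso; apply hne
    have k1 : b.1 - a.1 = 0 := by nlinarith [sq_nonneg (b.1 - a.1), sq_nonneg (b.2 - a.2)]
    have k2 : b.2 - a.2 = 0 := by nlinarith [sq_nonneg (b.1 - a.1), sq_nonneg (b.2 - a.2)]
    exact Prod.ext (by linarith) (by linarith)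

variable {E : Type} {R : E → E → Prop} {pw pb : E → Pt}

lemma Gd.shareW (h : Gd R pw pb) {e f f' : E} (r1 : R e f) (r2 : R e f') (hne : f ≠ f') {p : Pt}
    (hp : p ∈ segment ℝ (pw e) (pb f)) (hp' : p ∈ segment ℝ (pw e) (pb f')) : p = pw e := by
  rcases h.q e f e f' r1 r2 (Or.inr hne) p hp hp' with ⟨-, k⟩ | ⟨k, -⟩ | k
  · exact k
  · exact absurd k hne
  · exact orth_shared k (h.wb e f) hp hp'

lemma Gd.shareB (h : Gd R pw pb) {e e' f : E} (r1 : R e f) (r2 : R e' f) (hne : e ≠ e') {p : Pt}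
    (hp : p ∈ segment ℝ (pw e) (pb f)) (hp' : p ∈ segment ℝ (pw e') (pb f)) : p = pb f := by
  rcases h.q e f e' f r1 r2 (Or.inl hne) p hp hp' with ⟨k, -⟩ | ⟨-, k⟩ | k
  · exact absurd k hne
  · exact k
  · rw [segment_symm] at hp hp'
    refine orth_shared ?_ (h.wb e f).symm hp hp'
    unfold SegOrth at *; linarith

lemma Gd.offW (h : Gd R pw pb) {e f e' : E} (r1 : R e f) (hne : e ≠ e') :
    pw e' ∉ segment ℝ (pw e) (pb f) := by
  intro hp
  obtain ⟨f1, f2, r2, r3, hn⟩ := h.nw e'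
  have key : ∀ g, R e' g → SegOrth (pw e) (pb f) (pw e') (pb g) := by
    intro g hg
    have hl := left_mem_segment ℝ (pw e') (pb g)
    by_cases hgf : f = g
    · subst hgf
      exact absurd (h.shareB r1 hg hne hp hl) (h.wb _ _)
    · rcases h.q e f e' g r1 hg (Or.inl hne) _ hp hl with ⟨k, -⟩ | ⟨k, -⟩ | k
      · exact absurd k hne
      · exact absurd k hgf
      · exact k
  obtain ⟨k1, k2⟩ := orth_two (key f1 r2) (key f2 r3) hn
  exact h.wb e f (Prod.ext (by linarith) (by linarith))

lemma Gd.offB (h : Gd R pw pb) {e f f' : E} (r1 : R e f) (hne : f ≠ f') :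
    pb f' ∉ segment ℝ (pw e) (pb f) := by
  intro hp
  obtain ⟨e1, e2, r2, r3, hn⟩ := h.nb f'
  have key : ∀ g, R g f' → SegOrth (pw e) (pb f) (pb f') (pw g) := by
    intro g hg
    have hl := right_mem_segment ℝ (pw g) (pb f')
    by_cases hgf : e = g
    · subst hgf
      exact absurd (h.shareW r1 hg hne hp hl).symm (h.wb _ _)
    · rcases h.q e f g f' r1 hg (Or.inr hne) _ hp hl with ⟨k, -⟩ | ⟨k, -⟩ | k
      · exact absurd k hgf
      · exact absurd k hne
      · unfold SegOrth at *; linarith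
  obtain ⟨k1, k2⟩ := orth_two (key e1 r2) (key e2 r3) hn
  exact h.wb e f (Prod.ext (by linarith) (by linarith))

lemma rac_of_gd {V : Type} {G : SimpleGraph V} (h : Gd R pw pb) {W B : E → V} {p : V → Pt}
    (hW : ∀ e, p (W e) = pw e) (hB : ∀ e, p (B e) = pb e)
    (cov : ∀ v, (∃ e, v = W e) ∨ ∃ f, v = B f)
    (adj : ∀ u v, G.Adj u v → ∃ e f, R e f ∧ ((u = W e ∧ v = B f) ∨ (u = B f ∧ v = W e))) :
    IsRACDrawing G p := by
  have WB : ∀ e f, W e ≠ B f := fun e f hh => h.wb e f (by rw [← hW, ← hB, hh])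
  have Wi : ∀ e f, W e = W f → e = f := fun e f hh => h.injw (by rw [← hW, ← hW, hh])
  have Bi : ∀ e f, B e = B f → e = f := fun e f hh => h.injb (by rw [← hB, ← hB, hh])
  have off : ∀ e f w, R e f → w ≠ W e → w ≠ B f → p w ∉ segment ℝ (pw e) (pb f) := by
    intro e f w r1 h1 h2
    rcases cov w with ⟨e', rfl⟩ | ⟨f', rfl⟩
    · rw [hW]; exact h.offW r1 (fun hh => h1 (by rw [hh]))
    · rw [hB]; exact h.offB r1 (fun hh => h2 (by rw [hh]))
  refine ⟨?_, ?_, ?_, ?_⟩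
  · intro u v huv
    rcases cov u with ⟨e, rfl⟩ | ⟨e, rfl⟩ <;> rcases cov v with ⟨f, rfl⟩ | ⟨f, rfl⟩ <;>
      simp only [hW, hB] at huv
    · rw [h.injw huv]
    · exact absurd huv (h.wb _ _)
    · exact absurd huv.symm (h.wb _ _)
    · rw [h.injb huv]
  · intro u v w huv h1 h2
    obtain ⟨e, f, r1, ⟨rfl, rfl⟩ | ⟨rfl, rfl⟩⟩ := adj u v huv
    · rw [hW, hB]; exact off e f w r1 h1 h2
    · rw [hW, hB, segment_symm]; exact off e f w r1 h2 h1
  · rintro u v w huv huw hne q ⟨hq, hq'⟩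
    rw [Set.mem_singleton_iff]
    obtain ⟨e, f, r1, ⟨rfl, rfl⟩ | ⟨rfl, rfl⟩⟩ := adj u v huv
    · obtain ⟨e', f', r2, ⟨k, rfl⟩ | ⟨k, rfl⟩⟩ := adj _ w huw
      · have := Wi _ _ k
        subst this
        rw [hW, hB] at hq hq'
        rw [hW]
        exact h.shareW r1 r2 (fun hh => hne (by rw [hh])) hq hq'
      · exact absurd k (WB _ _)
    · obtain ⟨e', f', r2, ⟨k, rfl⟩ | ⟨k, rfl⟩⟩ := adj _ w huw
      · exact absurd k.symm (WB _ _)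
      · have := Bi _ _ k
        subst this
        rw [hW, hB, segment_symm] at hq hq'
        rw [hB]
        exact h.shareB r1 r2 (fun hh => hne (by rw [hh])) hq hq'
  · rintro u v u' v' huv huv' n1 n2 n3 n4 ⟨q, hq, hq'⟩
    have key : ∀ e f e' f', R e f → R e' f' → e ≠ e' → f ≠ f' → q ∈ segment ℝ (pw e) (pb f) →
        q ∈ segment ℝ (pw e') (pb f') → SegOrth (pw e) (pb f) (pw e') (pb f') := by
      intro e f e' f' r1 r2 m1 m2 a b
      rcases h.q e f e' f' r1 r2 (Or.inl m1) q a b with ⟨k, -⟩ | ⟨k, -⟩ | k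
      · exact absurd k m1
      · exact absurd k m2
      · exact k
    obtain ⟨e, f, r1, hh⟩ := adj u v huv
    obtain ⟨e', f', r2, hh'⟩ := adj u' v' huv'
    have m1 : e ≠ e' := by
      rintro rfl
      rcases hh with ⟨rfl, rfl⟩ | ⟨rfl, rfl⟩ <;> rcases hh' with ⟨rfl, rfl⟩ | ⟨rfl, rfl⟩ <;> tauto
    have m2 : f ≠ f' := by
      rintro rfl
      rcases hh with ⟨rfl, rfl⟩ | ⟨rfl, rfl⟩ <;> rcases hh' with ⟨rfl, rfl⟩ | ⟨rfl, rfl⟩ <;> tauto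
    have K := key e f e' f' r1 r2 m1 m2
    rcases hh with ⟨rfl, rfl⟩ | ⟨rfl, rfl⟩ <;> rcases hh' with ⟨rfl, rfl⟩ | ⟨rfl, rfl⟩ <;>
      simp only [hW, hB] at hq hq' ⊢
    · exact K hq hq'
    · rw [segment_symm] at hq'
      have := K hq hq'; unfold SegOrth at *; linarith
    · rw [segment_symm] at hq
      have := K hq hq'; unfold SegOrth at *; linarith
    · rw [segment_symm] at hq hq'
      have := K hq hq'; unfold SegOrth at *; linarith

lemma pm_step {α β : Type} [Fintype α] [Fintype β] (Q : α → β → Prop) (k : ℕ)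
    (h1 : ∀ a, (Finset.univ.filter (fun b => Q a b)).card = k + 1)
    (h2 : ∀ b, (Finset.univ.filter (fun a => Q a b)).card = k + 1) :
    ∃ f : α ≃ β, (∀ a, Q a (f a)) ∧
      (∀ a, (Finset.univ.filter (fun b => Q a b ∧ b ≠ f a)).card = k) ∧
      (∀ b, (Finset.univ.filter (fun a => Q a b ∧ b ≠ f a)).card = k) := by
  have hcard : Fintype.card α = Fintype.card β := by
    have a := Finset.card_mul_eq_card_mul (s := (Finset.univ : Finset α))
      (t := (Finset.univ : Finset β)) Q (m := k + 1) (n := k + 1)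
      (fun a _ => by simpa [Finset.bipartiteAbove] using h1 a)
      (fun b _ => by simpa [Finset.bipartiteBelow] using h2 b)
    simpa using a
  obtain ⟨g, gi, hg⟩ := (Finset.all_card_le_biUnion_card_iff_exists_injective
    (fun a => Finset.univ.filter (fun b => Q a b))).1 (by
      intro s
      have := Finset.card_mul_le_card_mul (s := s)
        (t := s.biUnion (fun a => Finset.univ.filter (fun b => Q a b))) Q (m := k + 1) (n := k + 1)
        (fun a ha => by
          rw [← h1 a]
          apply Finset.card_le_card
          intro b hb
          rw [Finset.mem_bipartiteAbove]
          exact ⟨Finset.mem_biUnion.2 ⟨a, ha, hb⟩, (Finset.mem_filter.1 hb).2⟩)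
        (fun b _ => by
          rw [← h2 b]
          apply Finset.card_le_card
          intro a ha
          rw [Finset.mem_bipartiteBelow] at ha
          simpa using ha.2)
      exact Nat.le_of_mul_le_mul_right this (by omega))
  have hb : Function.Bijective g := (Fintype.bijective_iff_injective_and_card g).2 ⟨gi, hcard⟩
  have hg' : ∀ a, Q a (g a) := fun a => by simpa using hg a
  refine ⟨Equiv.ofBijective g hb, hg', fun a => ?_, fun b => ?_⟩
  · have : (Finset.univ.filter (fun b => Q a b ∧ b ≠ g a)) =
        (Finset.univ.filter (fun b => Q a b)).erase (g a) := by
      ext b; simp [and_comm]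
    have h3 := Finset.card_erase_of_mem (s := Finset.univ.filter (fun b => Q a b)) (a := g a)
      (by simpa using hg' a)
    rw [h1 a] at h3
    simpa [this] using h3
  · obtain ⟨a0, rfl⟩ := hb.2 b
    have : (Finset.univ.filter (fun a => Q a (g a0) ∧ g a0 ≠ g a)) =
        (Finset.univ.filter (fun a => Q a (g a0))).erase a0 := by
      ext b; simp [and_comm, gi.eq_iff, eq_comm]
    have h3 := Finset.card_erase_of_mem (s := Finset.univ.filter (fun a => Q a (g a0))) (a := a0)
      (by simpa using hg' a0)
    rw [h2] at h3
    simpa [this] using h3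

lemma pm_three {α β : Type} [Fintype α] [Fintype β] (Q : α → β → Prop)
    (h1 : ∀ a, (Finset.univ.filter (fun b => Q a b)).card = 3)
    (h2 : ∀ b, (Finset.univ.filter (fun a => Q a b)).card = 3) :
    ∃ f1 f2 f3 : α ≃ β, (∀ a, f1 a ≠ f3 a) ∧ (∀ a, f2 a ≠ f3 a) ∧ (∀ a, f1 a ≠ f2 a) ∧
      ∀ a b, Q a b → b = f3 a ∨ b = f1 a ∨ b = f2 a := by
  obtain ⟨f1, a1, b1, c1⟩ := pm_step Q 2 h1 h2
  obtain ⟨f2, a2, b2, c2⟩ := pm_step (fun a b => Q a b ∧ b ≠ f1 a) 1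
    (fun a => by convert b1 a) (fun b => by convert c1 b)
  obtain ⟨f3, a3, b3, c3⟩ := pm_step (fun a b => (Q a b ∧ b ≠ f1 a) ∧ b ≠ f2 a) 0
    (fun a => by convert b2 a) (fun b => by convert c2 b)
  refine ⟨f1, f2, f3, fun a => (a3 a).1.2.symm, fun a => (a3 a).2.symm, fun a => (a2 a).2.symm, ?_⟩
  intro a b hab
  have := b3 a
  have h0 := Finset.card_eq_zero.1 this
  by_contra hcon
  push Not at hcon
  have hm : b ∈ (∅ : Finset β) := by
    rw [← h0]
    refine (@Finset.mem_filter _ _ (_) _ _).2 ⟨Finset.mem_univ b, ⟨⟨hab, hcon.2.1⟩, hcon.2.2⟩, hcon.1⟩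
  simp at hm

end transfer


lemma deg_filter {V : Type} [Fintype V] (G : SimpleGraph V) (P : V → Prop) (v : V)
    [Fintype {w // P w}] [DecidablePred (fun w : {w // P w} => G.Adj v w.1)]
    (hP : ∀ w, G.Adj v w → P w) (hd : vdeg G v = 3) :
    (Finset.univ.filter (fun w : {w // P w} => G.Adj v w.1)).card = 3 := by
  rw [← hd, vdeg, ← Set.ncard_coe_finset]
  refine Set.ncard_congr (fun w _ => w.1) ?_ ?_ ?_
  · intro a ha; simpa using ha
  · intro a b _ _ h; exact Subtype.ext h
  · intro b hb
    exact ⟨⟨b, hP b hb⟩, by simpa using hb, rfl⟩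

/-- There is an absolute constant `c` such that every bipartite
3-regular graph on `n` vertices admits a straight-line RAC drawing with all vertices on
integer grid points inside a square of side `c * n` (i.e. of `O(n²)` area). -/
theorem stmt11 :
    ∃ c : ℝ, 0 < c ∧
      ∀ (V : Type) [Fintype V] (G : SimpleGraph V),
        (∀ v : V, vdeg G v = 3) → G.Colorable 2 →
        ∃ p : V → Pt, IsRACDrawing G p ∧
          InGridSquare (c * (Fintype.card V : ℝ)) (Set.range p) := by
  refine ⟨4, by norm_num, ?_⟩
  intro V _ G hdeg hcol
  obtain ⟨C⟩ := hcol
  have hne : ∀ u v, G.Adj u v → (C u = 1 ↔ ¬ C v = 1) := by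
    intro u v h
    have h1 : C u ≠ C v := C.valid h
    generalize C u = a at *
    generalize C v = b at *
    fin_cases a <;> fin_cases b <;> simp_all
  obtain ⟨f1, f2, f3, d1, d2, d3, hQ⟩ := pm_three
    (fun (a : {v // C v = 1}) (b : {v // ¬ C v = 1}) => G.Adj a.1 b.1)
    (fun a => deg_filter G (fun v => ¬ C v = 1) a.1
      (fun w hw => (hne _ _ hw).1 a.2) (hdeg _))
    (fun b => by
      have := deg_filter G (fun v => C v = 1) b.1
        (fun w hw => (hne _ _ hw.symm).2 b.2) (hdeg _)
      convert this using 3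
      exact G.adj_comm _ _)
  obtain ⟨pw, pb, hg, gw, gb⟩ := draw_all _ {v // C v = 1} (f3.trans f1.symm) (f3.trans f2.symm) rfl
    (fun e h => d1 e (by
      have : f1.symm (f3 e) = e := h
      rw [Equiv.symm_apply_eq] at this; exact this.symm))
    (fun e h => d2 e (by
      have : f2.symm (f3 e) = e := h
      rw [Equiv.symm_apply_eq] at this; exact this.symm))
    (fun e h => by
      have h' : f1.symm (f3 e) = f2.symm (f3 e) := h
      apply d3 (f1.symm (f3 e))
      conv_rhs => rw [h']
      simp)
  let p : V → Pt := fun v => if h : C v = 1 then pb ⟨v, h⟩ else pw (f3.symm ⟨v, h⟩)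
  have key : ∀ (e : {v // C v = 1}) (w : {v // ¬ C v = 1}), G.Adj e.1 w.1 →
      EdgeRel (f3.trans f1.symm) (f3.trans f2.symm) (f3.symm w) e := by
    intro e w h
    rcases hQ e w h with h | h | h
    · left; simp [h]
    · right; left; simp [h]
    · right; right; simp [h]
  refine ⟨p, rac_of_gd hg (W := fun e => (f3 e).1) (B := fun e => e.1) ?_ ?_ ?_ ?_, ?_, 0, 0, ?_⟩
  · intro e
    simp [p, (f3 e).2]
  · intro e
    simp [p, e.2]
  · intro v
    by_cases h : C v = 1
    · exact Or.inr ⟨⟨v, h⟩, rfl⟩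
    · exact Or.inl ⟨f3.symm ⟨v, h⟩, by simp⟩
  · intro u v huv
    by_cases h : C u = 1
    · have hv := (hne _ _ huv).1 h
      exact ⟨f3.symm ⟨v, hv⟩, ⟨u, h⟩, key ⟨u, h⟩ ⟨v, hv⟩ huv, Or.inr ⟨rfl, by simp⟩⟩
    · have hv := (hne _ _ huv.symm).2 h
      exact ⟨f3.symm ⟨u, h⟩, ⟨v, hv⟩, key ⟨v, hv⟩ ⟨u, h⟩ huv.symm, Or.inl ⟨by simp, rfl⟩⟩
  · rintro q ⟨v, rfl⟩
    have hgr : Grid (4 * Fintype.card {v // C v = 1}) (p v) := by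
      by_cases h : C v = 1
      · simpa only [p, h, dif_pos] using gb ⟨v, h⟩
      · simpa only [p, h, dif_neg, not_false_eq_true] using gw (f3.symm ⟨v, h⟩)
    obtain ⟨a, b, -, -, h⟩ := hgr
    exact ⟨a, b, by simpa using h⟩
  · rintro q ⟨v, rfl⟩
    have hgr : Grid (4 * Fintype.card {v // C v = 1}) (p v) := by
      by_cases h : C v = 1
      · simpa only [p, h, dif_pos] using gb ⟨v, h⟩
      · simpa only [p, h, dif_neg, not_false_eq_true] using gw (f3.symm ⟨v, h⟩)
    obtain ⟨a, b, ha, hb, h⟩ := hgr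
    have hc : Fintype.card {v // C v = 1} ≤ Fintype.card V := Fintype.card_subtype_le _
    have ha' : (a : ℝ) ≤ 4 * (Fintype.card V : ℝ) := by exact_mod_cast (by omega)
    have hb' : (b : ℝ) ≤ 4 * (Fintype.card V : ℝ) := by exact_mod_cast (by omega)
    rw [h]
    exact ⟨by simp, by simpa using ha', by simp, by simpa using hb'⟩
end
end
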